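/- arXiv:2510.17091 — 2 statements merged into one kernel-verified Lean document; each statement's English description precedes it below -/
import Mathlib

section
/- Fix an integer n ≥ 2 and constants C₁, C₂ > 0. There exist ε₀ > 0 and a finite constant C > 0, depending only on n, C₁, C₂, such that for all ε ∈ (0, ε₀), all a′ ∈ [0, C₁ε³) and all b′ ∈ [0, C₂ε³), one has 0 ≤ λ(A_{1,1+ε}) − λ(A_{1−a′, 1+ε+b′}) ≤ C, with the first inequality strict whenever a′ + b′ > 0. -/
open Real MeasureTheory

noncomputable def dirichletEigenvalue (n : ℕ) (U : Set (EuclideanSpace ℝ (Fin n))) : ℝ :=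
  sInf {R : ℝ | ∃ f : EuclideanSpace ℝ (Fin n) → ℝ,
    ContDiff ℝ (⊤ : ℕ∞) f ∧ HasCompactSupport f ∧ tsupport f ⊆ U ∧ f ≠ 0 ∧
    R = (∫ x, ‖fderiv ℝ f x‖ ^ 2) / (∫ x, (f x) ^ 2)}

def annulus (n : ℕ) (a b : ℝ) : Set (EuclideanSpace ℝ (Fin n)) :=
  {x | a < ‖x‖ ∧ ‖x‖ < b}

structure IsTestFunction (n : ℕ) (U : Set (EuclideanSpace ℝ (Fin n)))
    (f : EuclideanSpace ℝ (Fin n) → ℝ) : Prop where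
  contDiff : ContDiff ℝ (⊤ : ℕ∞) f
  hasCompactSupport : HasCompactSupport f
  tsupport_subset : tsupport f ⊆ U
  ne_zero : f ≠ 0

namespace IsTestFunction

variable {n : ℕ} {U V : Set (EuclideanSpace ℝ (Fin n))} {f : EuclideanSpace ℝ (Fin n) → ℝ}

theorem mono (hf : IsTestFunction n U f) (hUV : U ⊆ V) : IsTestFunction n V f :=
  ⟨hf.1, hf.2, hf.3.trans hUV, hf.4⟩

theorem continuous_fderiv (hf : IsTestFunction n U f) : Continuous (fderiv ℝ f) :=
  hf.contDiff.continuous_fderiv (by simp)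

theorem differentiable (hf : IsTestFunction n U f) : Differentiable ℝ f :=
  hf.contDiff.differentiable (by simp)

theorem apply_eq_zero (hf : IsTestFunction n U f) {x : EuclideanSpace ℝ (Fin n)} (hx : x ∉ U) :
    f x = 0 :=
  image_eq_zero_of_notMem_tsupport fun h => hx (hf.tsupport_subset h)

theorem fderiv_eq_zero (hf : IsTestFunction n U f) {x : EuclideanSpace ℝ (Fin n)} (hx : x ∉ U) :
    fderiv ℝ f x = 0 :=
  image_eq_zero_of_notMem_tsupport fun h =>
    hx (hf.tsupport_subset (tsupport_fderiv_subset ℝ h))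

theorem integrable_sq (hf : IsTestFunction n U f) : Integrable fun x => f x ^ 2 :=
  (hf.contDiff.continuous.pow 2).integrable_of_hasCompactSupport
    (hf.hasCompactSupport.mono fun x hx h0 => hx (by simp [h0]))

theorem integrable_norm_fderiv_sq (hf : IsTestFunction n U f) :
    Integrable fun x => ‖fderiv ℝ f x‖ ^ 2 :=
  (hf.continuous_fderiv.norm.pow 2).integrable_of_hasCompactSupport
    ((hf.hasCompactSupport.fderiv ℝ).mono fun x hx h0 => hx (by simp [h0]))

theorem integral_sq_pos (hf : IsTestFunction n U f) : 0 < ∫ x, f x ^ 2 := by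
  obtain ⟨x, hx⟩ := Function.ne_iff.1 hf.ne_zero
  exact (hf.contDiff.continuous.pow 2).integral_pos_of_hasCompactSupport_nonneg_nonzero
    (hf.hasCompactSupport.mono fun x hx h0 => hx (by simp [h0]))
    (fun x => sq_nonneg (f x)) (x := x) (pow_ne_zero 2 hx)

end IsTestFunction

noncomputable def rayleighQuotient (n : ℕ) (f : EuclideanSpace ℝ (Fin n) → ℝ) : ℝ :=
  (∫ x, ‖fderiv ℝ f x‖ ^ 2) / (∫ x, (f x) ^ 2)

section Eigenvalue

variable {n : ℕ} {U V : Set (EuclideanSpace ℝ (Fin n))} {f : EuclideanSpace ℝ (Fin n) → ℝ}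

theorem rayleighQuotient_nonneg (f : EuclideanSpace ℝ (Fin n) → ℝ) : 0 ≤ rayleighQuotient n f :=
  div_nonneg (integral_nonneg fun _ => by positivity) (integral_nonneg fun _ => by positivity)

theorem dirichletEigenvalue_le (hf : IsTestFunction n U f) :
    dirichletEigenvalue n U ≤ rayleighQuotient n f := by
  refine csInf_le ⟨0, ?_⟩ ⟨f, hf.1, hf.2, hf.3, hf.4, rfl⟩
  rintro _ ⟨g, -, -, -, -, rfl⟩
  exact rayleighQuotient_nonneg g

theorem le_dirichletEigenvalue (hU : ∃ f, IsTestFunction n U f) {c : ℝ}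
    (h : ∀ f, IsTestFunction n U f → c ≤ rayleighQuotient n f) :
    c ≤ dirichletEigenvalue n U := by
  obtain ⟨f, hf⟩ := hU
  refine le_csInf ⟨_, f, hf.1, hf.2, hf.3, hf.4, rfl⟩ ?_
  rintro _ ⟨g, h1, h2, h3, h4, rfl⟩
  exact h g ⟨h1, h2, h3, h4⟩

theorem dirichletEigenvalue_anti (hU : ∃ f, IsTestFunction n U f) (hUV : U ⊆ V) :
    dirichletEigenvalue n V ≤ dirichletEigenvalue n U :=
  le_dirichletEigenvalue hU fun _ hf => dirichletEigenvalue_le (hf.mono hUV)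

theorem dirichletEigenvalue_nonneg : 0 ≤ dirichletEigenvalue n U := by
  refine Real.sInf_nonneg ?_
  rintro _ ⟨g, -, -, -, -, rfl⟩
  exact rayleighQuotient_nonneg g

theorem IsTestFunction.comp_affine (hf : IsTestFunction n U f) {t : ℝ} (ht : 0 < t)
    (p : EuclideanSpace ℝ (Fin n)) (hV : ∀ y ∈ U, p + t • y ∈ V) :
    IsTestFunction n V (fun x => f (t⁻¹ • (x - p))) := by
  let e : EuclideanSpace ℝ (Fin n) ≃ₜ EuclideanSpace ℝ (Fin n) :=
    (Homeomorph.subRight p).trans (Homeomorph.smulOfNeZero t⁻¹ (inv_ne_zero ht.ne'))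
  have hfe : (fun x => f (t⁻¹ • (x - p))) = f ∘ e := rfl
  have hinv : ∀ x, p + t • (t⁻¹ • (x - p)) = x := fun x => by
    rw [smul_inv_smul₀ ht.ne']; abel
  refine ⟨?_, ?_, ?_, ?_⟩
  · exact hf.contDiff.comp (by fun_prop)
  · rw [hfe]; exact hf.hasCompactSupport.comp_homeomorph e
  · intro x hx
    rw [hfe] at hx
    have := tsupport_comp_subset_preimage f e.continuous hx
    have h2 := hV _ (hf.tsupport_subset this)
    exact (hinv x) ▸ h2
  · intro h0
    refine hf.ne_zero (funext fun y => ?_)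
    have := congrFun h0 (p + t • y)
    simpa [inv_smul_smul₀ ht.ne'] using this

theorem rayleighQuotient_comp_affine (f : EuclideanSpace ℝ (Fin n) → ℝ) (hf : Differentiable ℝ f)
    {t : ℝ} (ht : 0 < t) (p : EuclideanSpace ℝ (Fin n)) :
    rayleighQuotient n (fun x => f (t⁻¹ • (x - p))) = rayleighQuotient n f / t ^ 2 := by
  have hder : ∀ x, ‖fderiv ℝ (fun x => f (t⁻¹ • (x - p))) x‖ ^ 2 =
      (t ^ 2)⁻¹ * ‖fderiv ℝ f (t⁻¹ • (x - p))‖ ^ 2 := fun x => by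
    have h1 : HasFDerivAt (fun x => t⁻¹ • (x - p))
        (t⁻¹ • ContinuousLinearMap.id ℝ (EuclideanSpace ℝ (Fin n))) x :=
      ((hasFDerivAt_id x).sub_const p).const_smul t⁻¹
    have h2 := ((hf (t⁻¹ • (x - p))).hasFDerivAt.comp x h1).fderiv
    have h3 : fderiv ℝ (fun x => f (t⁻¹ • (x - p))) x = t⁻¹ • fderiv ℝ f (t⁻¹ • (x - p)) := by
      refine h2.trans ?_
      ext v
      simp
    rw [h3, norm_smul, mul_pow, Real.norm_of_nonneg (by positivity), inv_pow]
  unfold rayleighQuotient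
  simp_rw [hder]
  have hs : ∀ g : EuclideanSpace ℝ (Fin n) → ℝ, ∫ x, g (t⁻¹ • (x - p)) = t ^ n * ∫ x, g x := by
    intro g
    rw [integral_sub_right_eq_self (fun x => g (t⁻¹ • x)) p, Measure.integral_comp_inv_smul,
      finrank_euclideanSpace_fin, abs_of_pos (by positivity), smul_eq_mul]
  rw [integral_const_mul, hs (fun x => ‖fderiv ℝ f x‖ ^ 2), hs (fun x => f x ^ 2)]
  have : t ^ n ≠ 0 := by positivity
  by_cases hM : ∫ x, f x ^ 2 = 0
  · simp [hM]
  field_simp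

theorem dirichletEigenvalue_le_of_affine (hU : ∃ f, IsTestFunction n U f) {t : ℝ} (ht : 0 < t)
    (p : EuclideanSpace ℝ (Fin n)) (hV : ∀ y ∈ U, p + t • y ∈ V) :
    dirichletEigenvalue n V ≤ dirichletEigenvalue n U / t ^ 2 := by
  rw [le_div_iff₀ (by positivity)]
  refine le_dirichletEigenvalue hU fun f hf => ?_
  rw [← le_div_iff₀ (by positivity), ← rayleighQuotient_comp_affine f hf.differentiable ht p]
  exact dirichletEigenvalue_le (hf.comp_affine ht p hV)

theorem exists_isTestFunction_ball {r : ℝ} (hr : 0 < r) :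
    ∃ f, IsTestFunction n (Metric.ball 0 r) f := by
  let b : ContDiffBump (0 : EuclideanSpace ℝ (Fin n)) := ⟨r / 4, r / 2, by linarith, by linarith⟩
  refine ⟨b, b.contDiff, b.hasCompactSupport, ?_, fun h => ?_⟩
  · rw [b.tsupport_eq]
    exact Metric.closedBall_subset_ball (by change r / 2 < r; linarith)
  · have h1 : b 0 = 1 := b.one_of_mem_closedBall (by simpa using b.rIn_pos.le)
    rw [h] at h1
    simp at h1

end Eigenvalue

section Annulus

variable {n : ℕ} {f : EuclideanSpace ℝ (Fin n) → ℝ}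

theorem annulus_mono {a b a' b' : ℝ} (ha : a' ≤ a) (hb : b ≤ b') :
    annulus n a b ⊆ annulus n a' b' :=
  fun _ hx => ⟨ha.trans_lt hx.1, hx.2.trans_le hb⟩

theorem isOpen_annulus (a b : ℝ) : IsOpen (annulus n a b) :=
  (isOpen_lt continuous_const continuous_norm).inter (isOpen_lt continuous_norm continuous_const)

theorem exists_center_annulus (hn : n ≠ 0) {a b : ℝ} (ha : 0 ≤ a) (hab : a < b) :
    ∃ p : EuclideanSpace ℝ (Fin n), ∀ y ∈ Metric.ball (0 : EuclideanSpace ℝ (Fin n)) (1 / 2),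
      p + (b - a) • y ∈ annulus n a b := by
  have : NeZero n := ⟨hn⟩
  refine ⟨((a + b) / 2) • EuclideanSpace.single 0 1, fun y hy => ?_⟩
  rw [mem_ball_zero_iff] at hy
  set p : EuclideanSpace ℝ (Fin n) := ((a + b) / 2) • EuclideanSpace.single 0 1 with hp
  have hpn : ‖p‖ = (a + b) / 2 := by
    rw [hp, norm_smul]; simp; linarith
  have hy2 : ‖(b - a) • y‖ < (b - a) / 2 := by
    rw [norm_smul, Real.norm_of_nonneg (by linarith)]
    nlinarith
  have h1 := norm_add_le p ((b - a) • y)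
  have h2 := norm_sub_le (p + (b - a) • y) ((b - a) • y)
  rw [add_sub_cancel_right] at h2
  exact ⟨by linarith, by linarith⟩

theorem exists_isTestFunction_annulus (hn : n ≠ 0) {a b : ℝ} (ha : 0 ≤ a) (hab : a < b) :
    ∃ f, IsTestFunction n (annulus n a b) f := by
  obtain ⟨f, hf⟩ := exists_isTestFunction_ball (n := n) (r := 1 / 2) (by norm_num)
  obtain ⟨p, hp⟩ := exists_center_annulus hn ha hab
  exact ⟨_, hf.comp_affine (sub_pos.2 hab) p hp⟩

theorem exists_dirichletEigenvalue_annulus_le (hn : n ≠ 0) :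
    ∃ C : ℝ, 0 < C ∧ ∀ a b : ℝ, 0 ≤ a → a < b →
      dirichletEigenvalue n (annulus n a b) ≤ C / (b - a) ^ 2 := by
  refine ⟨dirichletEigenvalue n (Metric.ball 0 (1 / 2)) + 1,
    add_pos_of_nonneg_of_pos dirichletEigenvalue_nonneg one_pos, fun a b ha hab => ?_⟩
  obtain ⟨p, hp⟩ := exists_center_annulus hn ha hab
  refine (dirichletEigenvalue_le_of_affine (exists_isTestFunction_ball (by norm_num))
    (sub_pos.2 hab) p hp).trans ?_
  gcongr
  linarith

end Annulus

/-- The square of the radial derivative of `f`. -/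
noncomputable def radialDerivSq (n : ℕ) (f : EuclideanSpace ℝ (Fin n) → ℝ)
    (x : EuclideanSpace ℝ (Fin n)) : ℝ :=
  (fderiv ℝ f x x) ^ 2 / ‖x‖ ^ 2

theorem contDiff_of_contDiffAt_tsupport {E : Type*} [NormedAddCommGroup E] [NormedSpace ℝ E]
    {k : WithTop ℕ∞} {g : E → ℝ} (h : ∀ x ∈ tsupport g, ContDiffAt ℝ k g x) : ContDiff ℝ k g := by
  refine contDiff_iff_contDiffAt.2 fun x => ?_
  by_cases hx : x ∈ tsupport g
  · exact h x hx
  · exact contDiffAt_const.congr_of_eventuallyEq (notMem_tsupport_iff_eventuallyEq.1 hx)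

section Poincare

variable {n : ℕ} {U : Set (EuclideanSpace ℝ (Fin n))} {f : EuclideanSpace ℝ (Fin n) → ℝ}

theorem radialDerivSq_nonneg (x : EuclideanSpace ℝ (Fin n)) : 0 ≤ radialDerivSq n f x := by
  unfold radialDerivSq; positivity

theorem radialDerivSq_le (x : EuclideanSpace ℝ (Fin n)) :
    radialDerivSq n f x ≤ ‖fderiv ℝ f x‖ ^ 2 := by
  refine div_le_of_le_mul₀ (by positivity) (by positivity) ?_
  rw [← mul_pow, ← sq_abs]
  gcongr
  exact (fderiv ℝ f x).le_opNorm x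

theorem IsTestFunction.integrable_radialDerivSq (hf : IsTestFunction n U f) :
    Integrable (radialDerivSq n f) := by
  refine hf.integrable_norm_fderiv_sq.mono' ?_ (Filter.Eventually.of_forall fun x => ?_)
  · have h1 : Continuous fun x => fderiv ℝ f x x := hf.continuous_fderiv.clm_apply continuous_id
    exact ((h1.measurable.pow_const 2).div (measurable_norm.pow_const 2)).aestronglyMeasurable
  · rw [Real.norm_of_nonneg (radialDerivSq_nonneg x)]
    exact radialDerivSq_le x

theorem integral_fderiv_apply_self {v : EuclideanSpace ℝ (Fin n) → ℝ} (hv : ContDiff ℝ 1 v)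
    (hc : HasCompactSupport v) : ∫ x, fderiv ℝ v x x = -(n * ∫ x, v x) := by
  have hcont : Continuous (fderiv ℝ v) := hv.continuous_fderiv (by simp)
  have hcs := hc.fderiv ℝ
  let e : Fin n → EuclideanSpace ℝ (Fin n) := fun i => EuclideanSpace.single i 1
  let pr : Fin n → EuclideanSpace ℝ (Fin n) →L[ℝ] ℝ := fun i => EuclideanSpace.proj i
  have hsum : ∀ x : EuclideanSpace ℝ (Fin n), x = ∑ i, pr i x • e i := fun x => by
    have := ((EuclideanSpace.basisFun (Fin n) ℝ).sum_repr x).symm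
    simpa [e, pr] using this
  have hint : ∀ i, Integrable fun x => fderiv ℝ v x (e i) * pr i x := fun i => by
    refine Continuous.integrable_of_hasCompactSupport
      ((hcont.clm_apply continuous_const).mul (pr i).continuous) ?_
    exact (hcs.comp_left (g := fun L : EuclideanSpace ℝ (Fin n) →L[ℝ] ℝ => L (e i))
      (by simp)).mul_right
  have hvi : Integrable v := hv.continuous.integrable_of_hasCompactSupport hc
  have hpart : ∀ i, ∫ x, fderiv ℝ v x (e i) * pr i x = -∫ x, v x := fun i => by
    have hpr : ∀ x, fderiv ℝ (pr i) x (e i) = 1 := fun x => by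
      rw [(pr i).fderiv]; simp [pr, e]
    have := integral_mul_fderiv_eq_neg_fderiv_mul_of_integrable (μ := volume) (f := v) (g := pr i)
      (v := e i) (hint i) (by simpa only [hpr, mul_one] using hvi)
      ((hv.continuous.mul (pr i).continuous).integrable_of_hasCompactSupport hc.mul_right)
      (fun x _ => hv.differentiable (by simp) x) (fun x _ => (pr i).differentiableAt)
    simp only [hpr, mul_one] at this
    rw [this, neg_neg]
  have hpt : ∀ x, fderiv ℝ v x x = ∑ i, fderiv ℝ v x (e i) * pr i x := fun x => by
    conv_lhs => rw [hsum x, map_sum]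
    rw [← hsum x]
    simp [mul_comm]
  simp_rw [hpt]
  rw [integral_finsetSum _ fun i _ => hint i]
  simp [hpart]

theorem IsTestFunction.integral_sq_le_radial (hn : 2 ≤ n) {ε : ℝ}
    (hf : IsTestFunction n (annulus n 1 (1 + ε)) f) :
    ∫ x, f x ^ 2 ≤ 4 * ε ^ 2 * ∫ x, radialDerivSq n f x := by
  set v : EuclideanSpace ℝ (Fin n) → ℝ := fun x => f x ^ 2 * (1 - (‖x‖ ^ 2)⁻¹) with hvdef
  have hvz : ∀ x ∉ tsupport f, v x = 0 := fun x hx => by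
    simp [hvdef, image_eq_zero_of_notMem_tsupport hx]
  have hts : tsupport v ⊆ tsupport f :=
    closure_minimal (fun x hx => by_contra fun h => hx (hvz x h)) (isClosed_tsupport f)
  have hcs : HasCompactSupport v :=
    hf.hasCompactSupport.of_isClosed_subset (isClosed_tsupport v) hts
  have hne : ∀ x ∈ annulus n 1 (1 + ε), ‖x‖ ^ 2 ≠ 0 := fun x hx => by
    have := hx.1; positivity
  have hvs : ContDiff ℝ 1 v := by
    refine contDiff_of_contDiffAt_tsupport fun x hx => ?_
    have hx' := hne x (hf.tsupport_subset (hts hx))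
    have h1 : ContDiffAt ℝ 1 f x := (hf.contDiff.of_le (by simp)).contDiffAt
    have h2 : ContDiffAt ℝ 1 (fun x : EuclideanSpace ℝ (Fin n) => ‖x‖ ^ 2) x :=
      (contDiff_norm_sq ℝ).contDiffAt
    exact (h1.pow 2).mul (contDiffAt_const.sub (h2.inv hx'))
  have hid := integral_fderiv_apply_self hvs hcs
  have hI1 : Integrable fun x => fderiv ℝ v x x :=
    ((hvs.continuous_fderiv (by simp)).clm_apply continuous_id).integrable_of_hasCompactSupport
      ((hcs.fderiv ℝ).mono fun x hx h0 => hx (by simp [h0]))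
  have hI2 : Integrable v := hvs.continuous.integrable_of_hasCompactSupport hcs
  have hzero : ∫ x, (n * v x + fderiv ℝ v x x) = 0 := by
    rw [integral_add (hI2.const_mul _) hI1, integral_const_mul, hid]; ring
  have hle : ∫ x, (f x ^ 2 - 4 * ε ^ 2 * radialDerivSq n f x) ≤
      ∫ x, (n * v x + fderiv ℝ v x x) := by
    refine integral_mono (hf.integrable_sq.sub (hf.integrable_radialDerivSq.const_mul _))
      ((hI2.const_mul _).add hI1) fun x => ?_
    by_cases hx : x ∈ annulus n 1 (1 + ε)
    · have hr := hx.1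
      have hr2 := hx.2
      have hd : fderiv ℝ v x x = 2 * f x * fderiv ℝ f x x * (1 - (‖x‖ ^ 2)⁻¹) +
          f x ^ 2 * (2 * (‖x‖ ^ 2)⁻¹) := by
        have h1 := ((hf.differentiable x).hasFDerivAt.pow 2)
        have h2 := (hasDerivAt_inv (hne x hx)).comp_hasFDerivAt x (hasStrictFDerivAt_norm_sq x).hasFDerivAt
        have h3 := (h1.mul (h2.const_sub 1)).fderiv
        have h4 : fderiv ℝ v x = _ := h3
        rw [h4]
        have hxx := hne x hx
        simp
        field_simp
        ring
      rw [hd]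
      simp only [hvdef, radialDerivSq, div_eq_mul_inv]
      set q := (‖x‖ ^ 2)⁻¹ with hq
      have hq0 : 0 < q := inv_pos.2 (by positivity)
      have hqr : q * ‖x‖ ^ 2 = 1 := inv_mul_cancel₀ (hne x hx)
      have hq1 : q ≤ 1 := inv_le_one_of_one_le₀ (by nlinarith)
      have hkey : (1 - q) ^ 2 ≤ 4 * ε ^ 2 * q := by
        have h1 : (1 - q) * ‖x‖ ≤ 2 * ε := by
          have : (1 - q) * ‖x‖ * ‖x‖ ≤ 2 * ε * ‖x‖ := by nlinarith
          exact le_of_mul_le_mul_right this (by linarith)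
        have h2 : ((1 - q) * ‖x‖) ^ 2 ≤ (2 * ε) ^ 2 :=
          pow_le_pow_left₀ (mul_nonneg (by linarith) (by linarith)) h1 2
        calc (1 - q) ^ 2 = ((1 - q) * ‖x‖) ^ 2 * q := by linear_combination (-(1 - q) ^ 2) * hqr
          _ ≤ (2 * ε) ^ 2 * q := by gcongr
          _ = _ := by ring
      have hn' : (2 : ℝ) ≤ n := by exact_mod_cast hn
      have h3 : 2 * (f x ^ 2 * (1 - q)) ≤ n * (f x ^ 2 * (1 - q)) :=
        mul_le_mul_of_nonneg_right hn' (mul_nonneg (sq_nonneg _) (by linarith))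
      have h4 := mul_le_mul_of_nonneg_left hkey (sq_nonneg (fderiv ℝ f x x))
      have h5 := sq_nonneg (f x + fderiv ℝ f x x * (1 - q))
      linarith
    · have h1 : v x = 0 := by simp [hvdef, hf.apply_eq_zero hx]
      have h2 : fderiv ℝ v x = 0 := image_eq_zero_of_notMem_tsupport fun h =>
        hx (hf.tsupport_subset (hts (tsupport_fderiv_subset ℝ h)))
      simp [h1, h2, radialDerivSq, hf.apply_eq_zero hx, hf.fderiv_eq_zero hx]
  rw [hzero, integral_sub hf.integrable_sq (hf.integrable_radialDerivSq.const_mul _),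
    integral_const_mul] at hle
  linarith

end Poincare

/-- The map acting as `m` on the orthogonal complement of `x` and as `m + d * ‖x‖ ^ 2` on `x`. -/
noncomputable def radialLinearMap {n : ℕ} (x : EuclideanSpace ℝ (Fin n)) (m d : ℝ) :
    EuclideanSpace ℝ (Fin n) →L[ℝ] EuclideanSpace ℝ (Fin n) :=
  m • ContinuousLinearMap.id ℝ _ + (d • innerSL ℝ x).smulRight x

/-- The radial map sending the sphere of radius `r` to the sphere of radius `ρ`,
where `ρ ^ n = κ * r ^ n + c`. -/
noncomputable def radialPowMap (n : ℕ) (κ c : ℝ) (x : EuclideanSpace ℝ (Fin n)) :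
    EuclideanSpace ℝ (Fin n) :=
  (κ + c / ‖x‖ ^ n) ^ (1 / n : ℝ) • x

section RadialMap

variable {n : ℕ} {x : EuclideanSpace ℝ (Fin n)} {κ c : ℝ}

theorem det_radialLinearMap {m : ℝ} (hm : m ≠ 0) (d : ℝ) :
    (radialLinearMap x m d).det = m ^ n * (1 + d / m * ‖x‖ ^ 2) := by
  have h : ((radialLinearMap x m d : EuclideanSpace ℝ (Fin n) →L[ℝ] EuclideanSpace ℝ (Fin n)) :
      EuclideanSpace ℝ (Fin n) →ₗ[ℝ] EuclideanSpace ℝ (Fin n)) =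
      m • LinearMap.transvection (((d / m) • innerSL ℝ x :
        EuclideanSpace ℝ (Fin n) →L[ℝ] ℝ) : EuclideanSpace ℝ (Fin n) →ₗ[ℝ] ℝ) x := by
    ext v : 1
    simp [radialLinearMap, LinearMap.transvection.apply, smul_smul]
    congr 1
    field_simp
  rw [ContinuousLinearMap.det, h, LinearMap.det_smul, LinearMap.transvection.det]
  simp

theorem norm_comp_radialLinearMap_sq (hx : x ≠ 0) (L : EuclideanSpace ℝ (Fin n) →L[ℝ] ℝ)
    (m d : ℝ) : ‖L.comp (radialLinearMap x m d)‖ ^ 2 =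
      m ^ 2 * (‖L‖ ^ 2 - (L x) ^ 2 / ‖x‖ ^ 2) +
        (m + d * ‖x‖ ^ 2) ^ 2 * ((L x) ^ 2 / ‖x‖ ^ 2) := by
  obtain ⟨w, rfl⟩ := (InnerProductSpace.toDual ℝ (EuclideanSpace ℝ (Fin n))).surjective L
  have h : (InnerProductSpace.toDual ℝ (EuclideanSpace ℝ (Fin n)) w).comp
      (radialLinearMap x m d) = InnerProductSpace.toDual ℝ (EuclideanSpace ℝ (Fin n))
        (m • w + (d * inner ℝ w x) • x) := by
    ext v
    simp [radialLinearMap]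
    ring
  have hx' : ‖x‖ ≠ 0 := norm_ne_zero_iff.2 hx
  rw [h, LinearIsometryEquiv.norm_map, LinearIsometryEquiv.norm_map,
    InnerProductSpace.toDual_apply_apply, norm_add_sq_real, norm_smul, norm_smul, mul_pow, mul_pow,
    inner_smul_left, inner_smul_right, Real.norm_eq_abs, Real.norm_eq_abs, sq_abs, sq_abs]
  simp only [conj_trivial]
  field_simp
  ring

theorem contDiffAt_radialPowMap (hx : x ≠ 0) (hμ : 0 < κ + c / ‖x‖ ^ n) {k : WithTop ℕ∞} :
    ContDiffAt ℝ k (radialPowMap n κ c) x := by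
  have hx' : ‖x‖ ≠ 0 := norm_ne_zero_iff.2 hx
  have h1 : ContDiffAt ℝ k (fun y : EuclideanSpace ℝ (Fin n) => ‖y‖) x := contDiffAt_norm ℝ hx
  exact ((contDiffAt_const.add (contDiffAt_const.div (h1.pow n) (pow_ne_zero n hx'))).rpow_const_of_ne
    hμ.ne').smul contDiffAt_id

theorem hasFDerivAt_radialPowMap (hn : n ≠ 0) (hx : x ≠ 0) (hμ : 0 < κ + c / ‖x‖ ^ n) :
    HasFDerivAt (radialPowMap n κ c)
      (radialLinearMap x ((κ + c / ‖x‖ ^ n) ^ (1 / n : ℝ))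
        (-(c / ‖x‖ ^ n) * (κ + c / ‖x‖ ^ n) ^ (1 / n - 1 : ℝ) / ‖x‖ ^ 2)) x := by
  have hx' : 0 < ‖x‖ := norm_pos_iff.2 hx
  have hs : √(‖x‖ ^ 2) = ‖x‖ := Real.sqrt_sq hx'.le
  have h1 : HasDerivAt (fun t : ℝ => √t) (1 / (2 * ‖x‖)) (‖x‖ ^ 2) := by
    have h := Real.hasDerivAt_sqrt (x := ‖x‖ ^ 2) (by positivity)
    rwa [hs] at h
  have h2 : HasDerivAt (fun t : ℝ => κ + c / √t ^ n)
      (-(c * (n * ‖x‖ ^ (n - 1) * (1 / (2 * ‖x‖)))) / (‖x‖ ^ n) ^ 2) (‖x‖ ^ 2) := by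
    refine (((hasDerivAt_const (‖x‖ ^ 2) c).fun_div (h1.fun_pow n)
      (by rw [hs]; positivity)).const_add κ).congr_deriv ?_
    rw [hs]
    ring
  have h3 := ((h2.rpow_const (p := 1 / n) (Or.inl (by rw [hs]; exact hμ.ne'))).comp_hasFDerivAt x
    (hasStrictFDerivAt_norm_sq x).hasFDerivAt).smul (hasFDerivAt_id x)
  have heq : radialPowMap n κ c = fun y : EuclideanSpace ℝ (Fin n) =>
      (κ + c / √(‖y‖ ^ 2) ^ n) ^ (1 / n : ℝ) • y := by
    funext y; rw [radialPowMap, Real.sqrt_sq (norm_nonneg y)]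
  rw [heq]
  refine HasFDerivAt.congr_fderiv h3 ?_
  have hpow : ‖x‖ ^ n = ‖x‖ ^ (n - 1) * ‖x‖ := by
    rw [← pow_succ, Nat.sub_add_cancel (Nat.pos_of_ne_zero hn)]
  have hn' : (n : ℝ) ≠ 0 := by exact_mod_cast hn
  ext v : 1
  simp [radialLinearMap, hs]
  generalize (κ + c / ‖x‖ ^ n) ^ ((n : ℝ)⁻¹ - 1) = R
  congr 1
  rw [hpow]
  field_simp

theorem radialPowMap_norm_pow (hn : n ≠ 0) (hx : x ≠ 0) (hμ : 0 < κ + c / ‖x‖ ^ n) :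
    ‖radialPowMap n κ c x‖ ^ n = κ * ‖x‖ ^ n + c := by
  have hx' : ‖x‖ ≠ 0 := norm_ne_zero_iff.2 hx
  rw [radialPowMap, norm_smul, mul_pow, Real.norm_of_nonneg (Real.rpow_nonneg hμ.le _), one_div,
    Real.rpow_inv_natCast_pow hμ.le hn]
  field_simp

theorem radialPowMap_radialPowMap (hn : n ≠ 0) (hx : x ≠ 0) (hκ : κ ≠ 0)
    (hμ : 0 < κ + c / ‖x‖ ^ n) :
    radialPowMap n κ⁻¹ (-(c / κ)) (radialPowMap n κ c x) = x := by
  have hx' : 0 < ‖x‖ := norm_pos_iff.2 hx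
  have hpos : 0 < κ * ‖x‖ ^ n + c := by
    have : κ * ‖x‖ ^ n + c = (κ + c / ‖x‖ ^ n) * ‖x‖ ^ n := by field_simp
    rw [this]; positivity
  rw [radialPowMap, radialPowMap_norm_pow hn hx hμ, radialPowMap, smul_smul]
  have hinv : κ⁻¹ + -(c / κ) / (κ * ‖x‖ ^ n + c) = (κ + c / ‖x‖ ^ n)⁻¹ := by
    field_simp
    ring
  rw [hinv, Real.inv_rpow hμ.le, inv_mul_cancel₀ (Real.rpow_pos_of_pos hμ _).ne', one_smul]

theorem det_fderiv_radialPowMap (hn : n ≠ 0) (hx : x ≠ 0) (hμ : 0 < κ + c / ‖x‖ ^ n) :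
    (fderiv ℝ (radialPowMap n κ c) x).det = κ := by
  have hx' : 0 < ‖x‖ := norm_pos_iff.2 hx
  rw [(hasFDerivAt_radialPowMap hn hx hμ).fderiv,
    det_radialLinearMap (Real.rpow_pos_of_pos hμ _).ne', Real.rpow_sub_one hμ.ne', one_div,
    Real.rpow_inv_natCast_pow hμ.le hn]
  have := (Real.rpow_pos_of_pos hμ (n : ℝ)⁻¹).ne'
  have := hμ.ne'
  generalize hm : (κ + c / ‖x‖ ^ n) ^ (n : ℝ)⁻¹ = m at *
  generalize hC : c / ‖x‖ ^ n = C at *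
  field_simp
  ring

theorem norm_fderiv_comp_radialPowMap_sq (hn : n ≠ 0) (hx : x ≠ 0) (hμ : 0 < κ + c / ‖x‖ ^ n)
    {f : EuclideanSpace ℝ (Fin n) → ℝ} (hf : Differentiable ℝ f) :
    ‖fderiv ℝ (f ∘ radialPowMap n κ c) x‖ ^ 2 =
      ((κ + c / ‖x‖ ^ n) ^ (1 / n : ℝ)) ^ 2 * (‖fderiv ℝ f (radialPowMap n κ c x)‖ ^ 2 -
        radialDerivSq n f (radialPowMap n κ c x)) +
      (κ * (κ + c / ‖x‖ ^ n) ^ (1 / n - 1 : ℝ)) ^ 2 *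
        radialDerivSq n f (radialPowMap n κ c x) := by
  have hx' : 0 < ‖x‖ := norm_pos_iff.2 hx
  have hm := Real.rpow_pos_of_pos hμ (1 / n : ℝ)
  have hr : radialDerivSq n f (radialPowMap n κ c x) =
      (fderiv ℝ f (radialPowMap n κ c x) x) ^ 2 / ‖x‖ ^ 2 := by
    have h1 : radialPowMap n κ c x = (κ + c / ‖x‖ ^ n) ^ (1 / n : ℝ) • x := rfl
    rw [radialDerivSq]
    generalize fderiv ℝ f (radialPowMap n κ c x) = L
    rw [h1, map_smul, norm_smul, Real.norm_of_nonneg hm.le, smul_eq_mul, mul_pow, mul_pow]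
    generalize (κ + c / ‖x‖ ^ n) ^ (1 / n : ℝ) = m at hm
    field_simp
  rw [((hf _).hasFDerivAt.comp x (hasFDerivAt_radialPowMap hn hx hμ)).fderiv,
    norm_comp_radialLinearMap_sq hx, hr]
  congr 3
  rw [Real.rpow_sub_one hμ.ne']
  have := hμ.ne'
  generalize hC : c / ‖x‖ ^ n = C at *
  field_simp
  ring

end RadialMap

section Transplantation

variable {n : ℕ} {κ c α β α' β' : ℝ}

theorem radialPowMap_mem_annulus (hn : n ≠ 0) (hα : 0 < α) (hα' : 0 < α') (hβ' : 0 < β')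
    (hκ : 0 < κ) (h1 : κ * α ^ n + c = α' ^ n) (h2 : κ * β ^ n + c = β' ^ n)
    {x : EuclideanSpace ℝ (Fin n)} (hx : x ∈ annulus n α β) :
    x ≠ 0 ∧ 0 < κ + c / ‖x‖ ^ n ∧ radialPowMap n κ c x ∈ annulus n α' β' := by
  have hx0 : 0 < ‖x‖ := hα.trans hx.1
  have hl : α' ^ n < κ * ‖x‖ ^ n + c := by
    rw [← h1]; gcongr; exact hx.1
  have hu : κ * ‖x‖ ^ n + c < β' ^ n := by
    rw [← h2]; gcongr; exact hx.2
  have hμ : 0 < κ + c / ‖x‖ ^ n := by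
    have : κ + c / ‖x‖ ^ n = (κ * ‖x‖ ^ n + c) / ‖x‖ ^ n := by field_simp
    rw [this]
    exact div_pos ((pow_pos hα' n).trans hl) (by positivity)
  refine ⟨norm_pos_iff.1 hx0, hμ, ?_, ?_⟩
  · rw [← radialPowMap_norm_pow hn (norm_pos_iff.1 hx0) hμ] at hl
    exact lt_of_pow_lt_pow_left₀ n (norm_nonneg _) hl
  · rw [← radialPowMap_norm_pow hn (norm_pos_iff.1 hx0) hμ] at hu
    exact lt_of_pow_lt_pow_left₀ n hβ'.le hu

theorem dirichletEigenvalue_annulus_le_transplant (hn : n ≠ 0) (hα : 0 < α) (hβ : 0 < β)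
    (hα' : 0 < α') (hβ' : 0 < β')
    (hκ : 0 < κ) (h1 : κ * α ^ n + c = α' ^ n) (h2 : κ * β ^ n + c = β' ^ n) {P Q : ℝ}
    (hP : ∀ r ∈ Set.Ioo α β, ((κ + c / r ^ n) ^ (1 / n : ℝ)) ^ 2 ≤ P)
    (hQ : ∀ r ∈ Set.Ioo α β, (κ * (κ + c / r ^ n) ^ (1 / n - 1 : ℝ)) ^ 2 ≤ Q)
    {f : EuclideanSpace ℝ (Fin n) → ℝ} (hf : IsTestFunction n (annulus n α' β') f) :
    dirichletEigenvalue n (annulus n α β) ≤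
      (P * ((∫ x, ‖fderiv ℝ f x‖ ^ 2) - ∫ x, radialDerivSq n f x) +
        Q * ∫ x, radialDerivSq n f x) / ∫ x, f x ^ 2 := by
  set Φ := radialPowMap n κ c with hΦ
  set Ψ := radialPowMap n κ⁻¹ (-(c / κ)) with hΨ
  set A := annulus n α β
  set A' := annulus n α' β'
  have hA : ∀ x ∈ A, x ≠ 0 ∧ 0 < κ + c / ‖x‖ ^ n ∧ Φ x ∈ A' := fun x hx =>
    radialPowMap_mem_annulus hn hα hα' hβ' hκ h1 h2 hx
  have hA' : ∀ y ∈ A', y ≠ 0 ∧ 0 < κ⁻¹ + -(c / κ) / ‖y‖ ^ n ∧ Ψ y ∈ A := fun y hy =>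
    radialPowMap_mem_annulus hn hα' hα hβ (inv_pos.2 hκ)
      (by rw [← h1]; field_simp; ring) (by rw [← h2]; field_simp; ring) hy
  have hΨΦ : ∀ x ∈ A, Ψ (Φ x) = x := fun x hx =>
    radialPowMap_radialPowMap hn (hA x hx).1 hκ.ne' (hA x hx).2.1
  have hΦΨ : ∀ y ∈ A', Φ (Ψ y) = y := fun y hy => by
    have := radialPowMap_radialPowMap hn (hA' y hy).1 (inv_ne_zero hκ.ne') (hA' y hy).2.1
    rwa [inv_inv, show -(-(c / κ) / κ⁻¹) = c by field_simp] at this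
  have hAo : IsOpen A := isOpen_annulus α β
  have himage : Φ '' A = A' := by
    ext y
    exact ⟨fun ⟨x, hx, h⟩ => h ▸ (hA x hx).2.2, fun hy => ⟨Ψ y, (hA' y hy).2.2, hΦΨ y hy⟩⟩
  have hinj : Set.InjOn Φ A := Set.LeftInvOn.injOn hΨΦ
  have hder : ∀ x ∈ A, HasFDerivWithinAt Φ (fderiv ℝ Φ x) A x := fun x hx =>
    (hasFDerivAt_radialPowMap hn (hA x hx).1 (hA x hx).2.1).differentiableAt.hasFDerivAt
      |>.hasFDerivWithinAt
  have hdet : ∀ x ∈ A, |(fderiv ℝ Φ x).det| = κ := fun x hx => by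
    rw [det_fderiv_radialPowMap hn (hA x hx).1 (hA x hx).2.1, abs_of_pos hκ]
  have hchange : ∀ F : EuclideanSpace ℝ (Fin n) → ℝ,
      ∫ x in A, F (Φ x) = κ⁻¹ * ∫ y in A', F y := fun F => by
    have h3 : ∫ x in A, |(fderiv ℝ Φ x).det| • F (Φ x) = ∫ x in A, κ * F (Φ x) :=
      setIntegral_congr_fun hAo.measurableSet fun x hx => by
        simp only [hdet x hx, smul_eq_mul]
    rw [← himage, integral_image_eq_integral_abs_det_fderiv_smul volume hAo.measurableSet hder hinj,
      h3, integral_const_mul, inv_mul_cancel_left₀ hκ.ne']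
  have hchangeInt : ∀ F : EuclideanSpace ℝ (Fin n) → ℝ, Integrable F →
      IntegrableOn (fun x => F (Φ x)) A := fun F hF => by
    have h3 := (integrableOn_image_iff_integrableOn_abs_det_fderiv_smul volume hAo.measurableSet
      hder hinj F).1 hF.integrableOn
    have h4 : IntegrableOn (fun x => κ * F (Φ x)) A := h3.congr_fun
      (fun x hx => by simp only [hdet x hx, smul_eq_mul]) hAo.measurableSet
    have h5 : IntegrableOn (fun x => κ⁻¹ * (κ * F (Φ x))) A := Integrable.const_mul h4 κ⁻¹
    simpa only [inv_mul_cancel_left₀ hκ.ne'] using h5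
  set g : EuclideanSpace ℝ (Fin n) → ℝ := A.indicator (f ∘ Φ) with hg
  have hgA : ∀ x ∈ A, g =ᶠ[nhds x] f ∘ Φ := fun x hx =>
    Filter.eventuallyEq_of_mem (hAo.mem_nhds hx) fun y hy => Set.indicator_of_mem hy _
  have hK : IsCompact (Ψ '' tsupport f) :=
    hf.hasCompactSupport.isCompact.image_of_continuousOn fun y hy =>
      have hy' := hA' y (hf.tsupport_subset hy)
      (contDiffAt_radialPowMap (k := 1) hy'.1 hy'.2.1).continuousAt.continuousWithinAt
  have hgK : tsupport g ⊆ Ψ '' tsupport f := by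
    refine closure_minimal (fun x hx => ?_) hK.isClosed
    have hxA : x ∈ A := Set.mem_of_indicator_ne_zero hx
    refine ⟨Φ x, subset_tsupport f ?_, hΨΦ x hxA⟩
    rwa [Function.mem_support, hg, Set.indicator_of_mem hxA] at hx
  have hKA : Ψ '' tsupport f ⊆ A := by
    rintro _ ⟨y, hy, rfl⟩
    exact (hA' y (hf.tsupport_subset hy)).2.2
  have hgtest : IsTestFunction n A g := by
    refine ⟨contDiff_of_contDiffAt_tsupport fun x hx => ?_,
      hK.of_isClosed_subset (isClosed_tsupport g) hgK, hgK.trans hKA, fun h0 => ?_⟩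
    · have hxA := hKA (hgK hx)
      exact (hf.contDiff.contDiffAt.comp x
        (contDiffAt_radialPowMap (hA x hxA).1 (hA x hxA).2.1)).congr_of_eventuallyEq (hgA x hxA)
    · refine hf.ne_zero (funext fun y => ?_)
      by_cases hy : y ∈ A'
      · have h3 := congrFun h0 (Ψ y)
        rwa [hg, Set.indicator_of_mem (hA' y hy).2.2, Function.comp_apply, hΦΨ y hy] at h3
      · exact hf.apply_eq_zero hy
  have hmass : ∫ x, g x ^ 2 = κ⁻¹ * ∫ y, f y ^ 2 := by
    rw [← setIntegral_eq_integral_of_forall_compl_eq_zero (s := A) (f := fun x => g x ^ 2)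
        (fun x hx => by rw [hgtest.apply_eq_zero hx, zero_pow two_ne_zero]),
      ← setIntegral_eq_integral_of_forall_compl_eq_zero (s := A') (f := fun y => f y ^ 2)
        (fun x hx => by rw [hf.apply_eq_zero hx, zero_pow two_ne_zero]),
      ← hchange fun y => f y ^ 2]
    refine setIntegral_congr_fun hAo.measurableSet fun x hx => ?_
    simp only [hg, Set.indicator_of_mem hx, Function.comp_apply]
  set F : EuclideanSpace ℝ (Fin n) → ℝ := fun y =>
    P * (‖fderiv ℝ f y‖ ^ 2 - radialDerivSq n f y) + Q * radialDerivSq n f y with hF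
  have hTint : Integrable fun y => ‖fderiv ℝ f y‖ ^ 2 - radialDerivSq n f y :=
    hf.integrable_norm_fderiv_sq.sub hf.integrable_radialDerivSq
  have hFint : Integrable F := (hTint.const_mul P).add (hf.integrable_radialDerivSq.const_mul Q)
  have henergy : ∫ x, ‖fderiv ℝ g x‖ ^ 2 ≤ κ⁻¹ * ∫ y, F y := by
    rw [← setIntegral_eq_integral_of_forall_compl_eq_zero (s := A)
        (fun x hx => by rw [hgtest.fderiv_eq_zero hx, norm_zero, zero_pow two_ne_zero]),
      ← setIntegral_eq_integral_of_forall_compl_eq_zero (s := A') (f := F)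
        (fun x hx => by simp [hF, radialDerivSq, hf.fderiv_eq_zero hx]), ← hchange]
    refine setIntegral_mono_on hgtest.integrable_norm_fderiv_sq.integrableOn (hchangeInt F hFint)
      hAo.measurableSet fun x hx => ?_
    rw [(hgA x hx).fderiv_eq, norm_fderiv_comp_radialPowMap_sq hn (hA x hx).1 (hA x hx).2.1
      hf.differentiable]
    exact add_le_add
      (mul_le_mul_of_nonneg_right (hP _ hx) (sub_nonneg.2 (radialDerivSq_le _)))
      (mul_le_mul_of_nonneg_right (hQ _ hx) (radialDerivSq_nonneg _))
  have hFeq : ∫ y, F y = P * ((∫ x, ‖fderiv ℝ f x‖ ^ 2) - ∫ x, radialDerivSq n f x) +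
      Q * ∫ x, radialDerivSq n f x := by
    rw [hF, integral_add (hTint.const_mul P) (hf.integrable_radialDerivSq.const_mul Q),
      integral_const_mul, integral_const_mul,
      integral_sub hf.integrable_norm_fderiv_sq hf.integrable_radialDerivSq]
  refine (dirichletEigenvalue_le hgtest).trans ?_
  rw [rayleighQuotient, hmass, ← hFeq, ← mul_div_mul_left (∫ y, F y) _ (inv_ne_zero hκ.ne')]
  exact div_le_div_of_nonneg_right henergy
    (mul_nonneg (inv_pos.2 hκ).le hf.integral_sq_pos.le)

end Transplantation

section Comparison

variable {n : ℕ}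

theorem dirichletEigenvalue_annulus_le_mul (hn : n ≠ 0) {α β B : ℝ} (hα : 0 < α) (hα1 : α ≤ 1)
    (hB : 1 < B) (hβ : B ≤ β) :
    dirichletEigenvalue n (annulus n 1 B) ≤
      ((β ^ n - α ^ n) / (B ^ n - 1) / α ^ n) ^ 2 * dirichletEigenvalue n (annulus n α β) := by
  have hBn : 0 < B ^ n - 1 := sub_pos.2 (one_lt_pow₀ hB hn)
  have hw0 : 0 < α ^ n := by positivity
  have hw1 : α ^ n ≤ 1 := pow_le_one₀ hα.le hα1
  have hβn : B ^ n ≤ β ^ n := by gcongr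
  set w := α ^ n with hw
  set κ := (β ^ n - w) / (B ^ n - 1) with hκdef
  have hκ1 : 1 ≤ κ := by rw [hκdef, one_le_div hBn]; linarith
  have hκB : κ * (B ^ n - 1) = β ^ n - w := div_mul_cancel₀ _ hBn.ne'
  have hκw : κ ≤ κ / w := le_div_self (by linarith) hw0 hw1
  have hn1 : (1 / n : ℝ) ≤ 1 := by
    rw [div_le_one (by positivity)]; exact_mod_cast Nat.one_le_iff_ne_zero.2 hn
  have hμ : ∀ r ∈ Set.Ioo 1 B, w ≤ κ + (w - κ) / r ^ n ∧ κ + (w - κ) / r ^ n ≤ κ := fun r hr => by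
    have hr1 : 1 ≤ r ^ n := one_le_pow₀ hr.1.le
    have h1 : (κ - w) / r ^ n ≤ κ - w := div_le_self (by linarith) hr1
    have h2 : 0 ≤ (κ - w) / r ^ n := div_nonneg (by linarith) (by linarith)
    have h3 : (w - κ) / r ^ n = -((κ - w) / r ^ n) := by rw [← neg_div, neg_sub]
    constructor <;> linarith
  have hPQ : 0 < (κ / w) ^ 2 := by positivity
  rw [← div_le_iff₀' hPQ]
  refine le_dirichletEigenvalue
    (exists_isTestFunction_annulus hn hα.le (by linarith)) fun f hf => ?_
  rw [div_le_iff₀' hPQ]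
  refine (dirichletEigenvalue_annulus_le_transplant hn one_pos (by linarith) hα (by linarith)
    (κ := κ) (c := w - κ) (P := (κ / w) ^ 2) (Q := (κ / w) ^ 2) (by linarith)
    (by rw [one_pow]; linarith) (by linarith) (fun r hr => ?_) (fun r hr => ?_) hf).trans_eq ?_
  · obtain ⟨h1, h2⟩ := hμ r hr
    have h0 : 0 < κ + (w - κ) / r ^ n := by linarith
    refine pow_le_pow_left₀ (Real.rpow_nonneg h0.le _) (le_trans ?_ hκw) 2
    calc (κ + (w - κ) / r ^ n) ^ (1 / n : ℝ) ≤ κ ^ (1 / n : ℝ) :=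
          Real.rpow_le_rpow h0.le h2 (by positivity)
      _ ≤ κ ^ (1 : ℝ) := Real.rpow_le_rpow_of_exponent_le hκ1 hn1
      _ = κ := Real.rpow_one κ
  · obtain ⟨h1, h2⟩ := hμ r hr
    have h0 : 0 < κ + (w - κ) / r ^ n := by linarith
    refine pow_le_pow_left₀ (mul_nonneg (by linarith) (Real.rpow_nonneg h0.le _)) ?_ 2
    rw [div_eq_mul_inv]
    refine mul_le_mul_of_nonneg_left ?_ (by linarith)
    calc (κ + (w - κ) / r ^ n) ^ (1 / n - 1 : ℝ) ≤ w ^ (1 / n - 1 : ℝ) :=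
          Real.rpow_le_rpow_of_nonpos hw0 h1 (by linarith)
      _ ≤ w ^ (-1 : ℝ) := by
          refine Real.rpow_le_rpow_of_exponent_ge hw0 hw1 ?_
          have : (0 : ℝ) ≤ 1 / n := by positivity
          linarith
      _ = w⁻¹ := Real.rpow_neg_one w
  · rw [rayleighQuotient]; ring

theorem inv_le_dirichletEigenvalue_annulus (hn : 2 ≤ n) {ε : ℝ} (hε : 0 < ε) :
    (4 * ε ^ 2)⁻¹ ≤ dirichletEigenvalue n (annulus n 1 (1 + ε)) := by
  refine le_dirichletEigenvalue
    (exists_isTestFunction_annulus (by lia) zero_le_one (by linarith)) fun f hf => ?_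
  rw [rayleighQuotient, le_div_iff₀ hf.integral_sq_pos, inv_mul_le_iff₀ (by positivity)]
  refine (hf.integral_sq_le_radial hn).trans ?_
  exact mul_le_mul_of_nonneg_left (integral_mono hf.integrable_radialDerivSq
    hf.integrable_norm_fderiv_sq radialDerivSq_le) (by positivity)

theorem dirichletEigenvalue_annulus_outer_lt (hn : 2 ≤ n) {ε b : ℝ} (hε : 0 < ε) (hb : 0 < b) :
    dirichletEigenvalue n (annulus n 1 (1 + ε + b)) <
      dirichletEigenvalue n (annulus n 1 (1 + ε)) := by
  have ht : 1 < (1 + ε + b) / (1 + ε) := by rw [one_lt_div (by linarith)]; linarith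
  have hpos : 0 < dirichletEigenvalue n (annulus n 1 (1 + ε)) :=
    lt_of_lt_of_le (by positivity) (inv_le_dirichletEigenvalue_annulus hn hε)
  refine (dirichletEigenvalue_le_of_affine
    (exists_isTestFunction_annulus (by lia) zero_le_one (by linarith)) (t := (1 + ε + b) / (1 + ε))
    (by linarith) 0 fun y hy => ?_).trans_lt (div_lt_self hpos (one_lt_pow₀ ht two_ne_zero))
  have hnorm : ‖0 + ((1 + ε + b) / (1 + ε)) • y‖ = (1 + ε + b) / (1 + ε) * ‖y‖ := by
    rw [zero_add, norm_smul, Real.norm_of_nonneg (by linarith)]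
  refine ⟨?_, ?_⟩
  · rw [hnorm]; nlinarith [hy.1]
  · rw [hnorm, div_mul_eq_mul_div, div_lt_iff₀ (by linarith)]
    exact mul_lt_mul_of_pos_left hy.2 (by linarith)

theorem dirichletEigenvalue_annulus_inner_add_le (hn : 2 ≤ n) {ε α σ : ℝ} (hε : 0 < ε)
    (hα : 0 < α) (hα1 : α < 1) (hw : 1 / 2 ≤ α ^ n) (hσ : σ * ((1 + ε) ^ n - 1) = 1 - α ^ n)
    (hσ2 : σ ≤ 1 / 2) :
    dirichletEigenvalue n (annulus n α (1 + ε)) + σ * (4 * ε ^ 2)⁻¹ ≤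
      (1 + 2 * (1 - α ^ n)) * dirichletEigenvalue n (annulus n 1 (1 + ε)) := by
  have hn0 : n ≠ 0 := by lia
  set B := 1 + ε with hB
  have hB1 : 1 < B := by linarith
  have hBn : 0 < B ^ n - 1 := sub_pos.2 (one_lt_pow₀ hB1 hn0)
  have hw1 : α ^ n < 1 := pow_lt_one₀ hα.le hα1 hn0
  set w := α ^ n with hwdef
  have hσ0 : 0 < σ := by
    by_contra! h
    nlinarith
  set κ := (1 + σ)⁻¹ with hκdef
  have hκσ : κ * (1 + σ) = 1 := inv_mul_cancel₀ (by linarith)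
  have hκ0 : 0 < κ := inv_pos.2 (by linarith)
  have hκ1 : κ ≤ 1 := inv_le_one_of_one_le₀ (by linarith)
  have hκw : κ * (B ^ n - w) = B ^ n - 1 := by
    have : B ^ n - w = (B ^ n - 1) * (1 + σ) := by linarith
    rw [this]; linear_combination (B ^ n - 1) * hκσ
  have hκsq : κ ^ 2 ≤ 1 - σ := by
    have h1 : κ ^ 2 * (1 + σ) ^ 2 = 1 := by rw [← mul_pow, hκσ, one_pow]
    have h2 : 1 ≤ (1 - σ) * (1 + σ) ^ 2 := by nlinarith [mul_pos hσ0 hσ0]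
    exact le_of_mul_le_mul_right (h1.trans_le h2) (by positivity)
  have hμ : ∀ r ∈ Set.Ioo α B, 1 ≤ κ + B ^ n * (1 - κ) / r ^ n ∧
      κ + B ^ n * (1 - κ) / r ^ n ≤ 1 + 2 * (1 - w) := fun r hr => by
    have hr0 : 0 < r := hα.trans hr.1
    have hrB : r ^ n ≤ B ^ n := pow_le_pow_left₀ hr0.le hr.2.le n
    have hrw : w ≤ r ^ n := pow_le_pow_left₀ hα.le hr.1.le n
    have h1 : 1 - κ ≤ B ^ n * (1 - κ) / r ^ n := by
      rw [le_div_iff₀ (by positivity), mul_comm]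
      exact mul_le_mul_of_nonneg_right hrB (by linarith)
    have h2 : B ^ n * (1 - κ) / r ^ n ≤ B ^ n * (1 - κ) / w :=
      div_le_div_of_nonneg_left (mul_nonneg (by positivity) (by linarith)) (by linarith) hrw
    have h3 : κ + B ^ n * (1 - κ) / w = w⁻¹ := by
      have : w ≠ 0 := by linarith
      field_simp
      linarith
    have h4 : w⁻¹ ≤ 1 + 2 * (1 - w) := by
      rw [inv_le_iff_one_le_mul₀ (by linarith)]
      nlinarith
    constructor <;> linarith
  have hη : 0 < 1 + 2 * (1 - w) := by linarith
  rw [← div_le_iff₀' hη]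
  refine le_dirichletEigenvalue
    (exists_isTestFunction_annulus hn0 zero_le_one (by linarith)) fun f hf => ?_
  rw [div_le_iff₀' hη]
  have hn2 : (2 : ℝ) ≤ n := by exact_mod_cast hn
  have hP : ∀ r ∈ Set.Ioo α B,
      ((κ + B ^ n * (1 - κ) / r ^ n) ^ (1 / n : ℝ)) ^ 2 ≤ 1 + 2 * (1 - w) := fun r hr => by
    obtain ⟨h1, h2⟩ := hμ r hr
    rw [← Real.rpow_natCast, ← Real.rpow_mul (by linarith)]
    calc _ ≤ (κ + B ^ n * (1 - κ) / r ^ n) ^ (1 : ℝ) := by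
          refine Real.rpow_le_rpow_of_exponent_le h1 ?_
          rw [one_div_mul_eq_div, div_le_one (by linarith)]
          exact_mod_cast hn
      _ ≤ _ := by rwa [Real.rpow_one]
  have hQ : ∀ r ∈ Set.Ioo α B,
      (κ * (κ + B ^ n * (1 - κ) / r ^ n) ^ (1 / n - 1 : ℝ)) ^ 2 ≤ 1 - σ := fun r hr => by
    obtain ⟨h1, h2⟩ := hμ r hr
    refine le_trans (pow_le_pow_left₀ (mul_nonneg hκ0.le (Real.rpow_nonneg (by linarith) _))
      (mul_le_of_le_one_right hκ0.le ?_) 2) hκsq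
    refine Real.rpow_le_one_of_one_le_of_nonpos h1 ?_
    rw [sub_nonpos, div_le_one (by linarith)]
    linarith
  have hκα : κ * α ^ n + B ^ n * (1 - κ) = 1 ^ n := by
    rw [one_pow, ← hwdef]
    linarith
  have hmain := dirichletEigenvalue_annulus_le_transplant (α := α) (β := B) (α' := 1) (β' := B)
    hn0 hα (by linarith) one_pos (by linarith) hκ0 hκα (by ring) hP hQ hf
  have hM := hf.integral_sq_pos
  have hpoin := hf.integral_sq_le_radial hn
  rw [le_div_iff₀ hM] at hmain
  rw [rayleighQuotient, mul_div_assoc', le_div_iff₀ hM, add_mul]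
  have h5 : (4 * ε ^ 2)⁻¹ * ∫ x, f x ^ 2 ≤ ∫ x, radialDerivSq n f x := by
    rwa [inv_mul_le_iff₀ (by positivity)]
  have h6 := mul_le_mul_of_nonneg_left h5 hσ0.le
  have h7 : 0 ≤ ∫ x, radialDerivSq n f x := integral_nonneg fun x => radialDerivSq_nonneg x
  have h8 := mul_nonneg (by linarith : 0 ≤ 2 * (1 - w)) h7
  linarith

theorem one_add_mul_sq_sq_le {K x : ℝ} (hK : 0 ≤ K) (hx0 : 0 ≤ x) (hx1 : x ≤ 1) :
    ((1 + K * x) ^ 2) ^ 2 ≤ 1 + (1 + K) ^ 4 * x := by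
  have g2 : x ^ 2 ≤ x := pow_le_of_le_one hx0 hx1 (by norm_num)
  have g3 : x ^ 3 ≤ x := pow_le_of_le_one hx0 hx1 (by norm_num)
  have g4 : x ^ 4 ≤ x := pow_le_of_le_one hx0 hx1 (by norm_num)
  have f2 := mul_le_mul_of_nonneg_left g2 (by positivity : 0 ≤ 6 * K ^ 2)
  have f3 := mul_le_mul_of_nonneg_left g3 (by positivity : 0 ≤ 4 * K ^ 3)
  have f4 := mul_le_mul_of_nonneg_left g4 (by positivity : 0 ≤ K ^ 4)
  linarith

theorem pow_sub_pow_le_mul {x y : ℝ} (n : ℕ) (hx : 0 ≤ x) (hxy : x ≤ y) (hy : 1 ≤ y) :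
    y ^ n - x ^ n ≤ n * (y - x) * y ^ n := by
  have hy0 : 0 < y := by linarith
  have h1 := one_add_mul_le_pow (a := x / y - 1)
    (by have := div_nonneg hx hy0.le; linarith) n
  rw [add_sub_cancel, div_pow, le_div_iff₀ (by positivity)] at h1
  have h2 : (1 - x / y) ≤ y - x := by
    rw [one_sub_div hy0.ne']
    exact div_le_self (by linarith) hy
  have h3 : (n : ℝ) * (1 - x / y) * y ^ n ≤ n * (y - x) * y ^ n := by gcongr
  linarith

end Comparison

set_option maxHeartbeats 1000000 in
theorem stmt_16 (n : ℕ) (hn : 2 ≤ n) (C₁ C₂ : ℝ) (hC₁ : 0 < C₁) (hC₂ : 0 < C₂) :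
    ∃ ε₀ > (0 : ℝ), ∃ C > (0 : ℝ), ∀ ε ∈ Set.Ioo 0 ε₀,
      ∀ a' ∈ Set.Ico (0 : ℝ) (C₁ * ε ^ 3), ∀ b' ∈ Set.Ico (0 : ℝ) (C₂ * ε ^ 3),
        0 ≤ dirichletEigenvalue n (annulus n 1 (1 + ε)) -
            dirichletEigenvalue n (annulus n (1 - a') (1 + ε + b')) ∧
        dirichletEigenvalue n (annulus n 1 (1 + ε)) -
            dirichletEigenvalue n (annulus n (1 - a') (1 + ε + b')) ≤ C ∧
        (0 < a' + b' →
          0 < dirichletEigenvalue n (annulus n 1 (1 + ε)) -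
              dirichletEigenvalue n (annulus n (1 - a') (1 + ε + b'))) := by
  obtain ⟨C₀, hC₀, hC₀le⟩ := exists_dirichletEigenvalue_annulus_le (n := n) (by lia)
  have hn0 : n ≠ 0 := by lia
  have hn2 : (2 : ℝ) ≤ n := by exact_mod_cast hn
  set D : ℝ := 2 + 2 * n * C₁ + C₂ + 8 * C₀ * n * 2 ^ n with hD
  have hD1 : 0 ≤ 2 * n * C₁ := by positivity
  have hD2 : 0 ≤ 8 * C₀ * n * 2 ^ n := by positivity
  have hD0 : 0 < D := by linarith
  set K : ℝ := 3 ^ n * C₂ + 2 * n * C₁ with hK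
  have hK0 : 0 < K := by positivity
  refine ⟨1 / D, by positivity, (1 + K) ^ 4 * C₀, by positivity, ?_⟩
  rintro ε ⟨hε, hεD⟩ a ⟨ha0, ha⟩ b ⟨hb0, hb⟩
  rw [lt_div_iff₀ hD0] at hεD
  have hε1 : ε < 1 / 2 := by nlinarith
  have hε2 : ε ^ 2 ≤ ε := by nlinarith
  have hε3 : ε ^ 3 ≤ ε ^ 2 := by nlinarith [sq_nonneg ε]
  have e1 : ε * (2 * n * C₁) < 1 := by nlinarith
  have e2 : ε * C₂ < 1 := by nlinarith
  have e3 : ε * (8 * C₀ * n * 2 ^ n) < 1 := by nlinarith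
  have hnC : 0 < n * C₁ := by positivity
  have hna2 : n * a ≤ n * C₁ * ε ^ 2 := by
    rw [mul_assoc]
    refine mul_le_mul_of_nonneg_left (ha.le.trans ?_) (by linarith)
    exact mul_le_mul_of_nonneg_left hε3 hC₁.le
  have hna : n * a ≤ 1 / 2 := by nlinarith
  have ha1 : a < 1 := by nlinarith
  have hb1 : b ≤ 1 := by nlinarith
  have hw : 1 - n * a ≤ (1 - a) ^ n := by
    have := one_add_mul_le_pow (a := -a) (by linarith) n
    rw [← sub_eq_add_neg] at this
    linarith
  have hBn : 1 + n * ε ≤ (1 + ε) ^ n := one_add_mul_le_pow (by linarith) n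
  have hex := exists_isTestFunction_annulus (n := n) hn0 zero_le_one (lt_add_of_pos_right 1 hε)
  have hA0 := hC₀le 1 (1 + ε) zero_le_one (by linarith)
  rw [add_sub_cancel_left] at hA0
  have hmono : dirichletEigenvalue n (annulus n (1 - a) (1 + ε + b)) ≤
      dirichletEigenvalue n (annulus n 1 (1 + ε)) :=
    dirichletEigenvalue_anti hex (annulus_mono (by linarith) (by linarith))
  refine ⟨sub_nonneg.2 hmono, ?_, fun hab => sub_pos.2 ?_⟩
  · have hU := dirichletEigenvalue_annulus_le_mul (n := n) hn0 (α := 1 - a) (β := 1 + ε + b)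
      (B := 1 + ε) (by linarith) (by linarith) (by linarith) (by linarith)
    have hden : 0 < (1 + ε) ^ n - 1 := by nlinarith
    have hκ : ((1 + ε + b) ^ n - (1 - a) ^ n) / ((1 + ε) ^ n - 1) ≤ 1 + K * ε ^ 2 := by
      have h1 := pow_sub_pow_le_mul (x := 1 + ε) (y := 1 + ε + b) n (by linarith) (by linarith)
        (by linarith)
      have h2 : (1 + ε + b) ^ n ≤ 3 ^ n := pow_le_pow_left₀ (by linarith) (by linarith) n
      have h3 : (n : ℝ) * (1 + ε + b - (1 + ε)) * (1 + ε + b) ^ n ≤ n * (C₂ * ε ^ 3) * 3 ^ n := by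
        gcongr
        linarith
      have h4 : n * a ≤ n * (C₁ * ε ^ 3) := by gcongr
      have h5 : n * (C₂ * ε ^ 3) * 3 ^ n + n * (C₁ * ε ^ 3) ≤ K * ε ^ 2 * (n * ε) := by
        have h6 : 0 ≤ (2 * n - 1) * (C₁ * n * ε ^ 3) := mul_nonneg (by linarith) (by positivity)
        rw [hK]
        linarith
      have h7 : K * ε ^ 2 * (n * ε) ≤ K * ε ^ 2 * ((1 + ε) ^ n - 1) := by
        gcongr
        linarith
      rw [div_le_iff₀ hden]
      linarith
    have hwpos : 0 < (1 - a) ^ n := by linarith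
    have hκw : ((1 + ε + b) ^ n - (1 - a) ^ n) / ((1 + ε) ^ n - 1) / (1 - a) ^ n ≤
        (1 + K * ε ^ 2) ^ 2 := by
      rw [div_le_iff₀ hwpos]
      have h1 : 2 * n * C₁ * ε ^ 2 ≤ K * ε ^ 2 := by
        rw [hK]; gcongr; linarith [show 0 < 3 ^ n * C₂ by positivity]
      have h2 : 1 ≤ (1 + K * ε ^ 2) * (1 - a) ^ n := by
        have h3 : 1 - K * ε ^ 2 / 2 ≤ (1 - a) ^ n := by linarith
        have h4 : 1 / 2 ≤ (1 - a) ^ n := by linarith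
        have h5 : 0 ≤ K * ε ^ 2 := by positivity
        nlinarith [mul_nonneg h5 (sub_nonneg.2 h4)]
      calc _ ≤ (1 + K * ε ^ 2) * 1 := by rwa [mul_one]
        _ ≤ (1 + K * ε ^ 2) * ((1 + K * ε ^ 2) * (1 - a) ^ n) := by gcongr
        _ = _ := by ring
    have hnum : 0 ≤ (1 + ε + b) ^ n - (1 - a) ^ n :=
      sub_nonneg.2 (pow_le_pow_left₀ (by linarith) (by linarith) n)
    have hsq : (((1 + ε + b) ^ n - (1 - a) ^ n) / ((1 + ε) ^ n - 1) / (1 - a) ^ n) ^ 2 ≤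
        1 + (1 + K) ^ 4 * ε ^ 2 := by
      have h0 : 0 ≤ ((1 + ε + b) ^ n - (1 - a) ^ n) / ((1 + ε) ^ n - 1) / (1 - a) ^ n :=
        div_nonneg (div_nonneg hnum hden.le) hwpos.le
      exact (pow_le_pow_left₀ h0 hκw 2).trans
        (one_add_mul_sq_sq_le hK0.le (sq_nonneg ε) (by linarith))
    have hle := hU.trans (mul_le_mul_of_nonneg_right hsq dirichletEigenvalue_nonneg)
    have hfin : (1 + K) ^ 4 * ε ^ 2 * dirichletEigenvalue n (annulus n (1 - a) (1 + ε + b)) ≤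
        (1 + K) ^ 4 * ε ^ 2 * (C₀ / ε ^ 2) := by
      gcongr
      exact hmono.trans hA0
    have hcancel : (1 + K) ^ 4 * ε ^ 2 * (C₀ / ε ^ 2) = (1 + K) ^ 4 * C₀ := by field_simp
    linarith
  · rcases hb0.lt_or_eq with hbpos | hbz
    · refine (dirichletEigenvalue_anti ?_ (annulus_mono (by linarith) le_rfl)).trans_lt
        (dirichletEigenvalue_annulus_outer_lt hn hε hbpos)
      exact exists_isTestFunction_annulus hn0 zero_le_one (by linarith)
    · have hapos : 0 < a := by linarith
      rw [← hbz, add_zero]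
      have hden : 0 < (1 + ε) ^ n - 1 := by nlinarith
      have hw1 : (1 - a) ^ n < 1 := pow_lt_one₀ (by linarith) (by linarith) hn0
      set σ := (1 - (1 - a) ^ n) / ((1 + ε) ^ n - 1) with hσdef
      have hσ : σ * ((1 + ε) ^ n - 1) = 1 - (1 - a) ^ n := div_mul_cancel₀ _ hden.ne'
      have hσ0 : 0 < σ := div_pos (by linarith) hden
      have hσ2 : σ ≤ 1 / 2 := by
        rw [hσdef, div_le_iff₀ hden]
        have h1 : C₁ * ε ^ 2 ≤ 1 / 2 := by nlinarith
        have h2 : n * a ≤ n * (C₁ * ε ^ 3) := by gcongr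
        have h3 : n * (C₁ * ε ^ 3) ≤ 1 / 2 * (n * ε) := by
          have := mul_le_mul_of_nonneg_right h1 (by positivity : 0 ≤ n * ε)
          linarith
        linarith
      have hinner := dirichletEigenvalue_annulus_inner_add_le hn hε (α := 1 - a) (by linarith)
        (by linarith) (by linarith) hσ hσ2
      rw [← hσ] at hinner
      have hpow : (1 + ε) ^ n - 1 ≤ n * ε * 2 ^ n := by
        have h1 := pow_sub_pow_le_mul (x := 1) (y := 1 + ε) n (by linarith) (by linarith)
          (by linarith)
        rw [one_pow, add_sub_cancel_left] at h1
        refine h1.trans ?_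
        gcongr
        linarith
      have hstrict : 2 * (σ * ((1 + ε) ^ n - 1)) *
          dirichletEigenvalue n (annulus n 1 (1 + ε)) < σ * (4 * ε ^ 2)⁻¹ := by
        calc _ ≤ 2 * (σ * (n * ε * 2 ^ n)) * (C₀ / ε ^ 2) := by
              have := dirichletEigenvalue_nonneg (n := n) (U := annulus n 1 (1 + ε))
              gcongr
          _ = (ε * (8 * C₀ * n * 2 ^ n)) * (σ * (4 * ε ^ 2)⁻¹) := by field_simp; ring
          _ < 1 * (σ * (4 * ε ^ 2)⁻¹) := by gcongr
          _ = _ := one_mul _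
      linarith
end

section
/- Fix an integer n ≥ 2. Define Φ₁ : (0,1] → ℝ by Φ₁(t) := λ(A_{1,1+t}). Then Φ₁ is differentiable on (0,1] and there exist constants c, C > 0 depending only on n such that c·t^{−3} ≤ |Φ₁′(t)| ≤ C·t^{−3} for all t ∈ (0,1]. Moreover, for every ε ∈ (0,1] and b′ ≥ 0 with ε + b′ ≤ 1, the function Φ₂(t) := λ(A_{1−t, 1+ε+b′}) is differentiable on [0, 1/4), and there exist constants c′, C′ > 0 depending only on n such that c′·(ε + b′ + t)^{−3} ≤ |Φ₂′(t)| ≤ C′·(ε + b′ + t)^{−3} for all t ∈ [0, 1/4). -/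
open Real MeasureTheory

open Set Filter Topology

/-- A bounded, globally Lipschitz, time-dependent scalar field has a global integral curve. -/
theorem exists_forall_hasDerivAt_of_lipschitz_of_bounded {f : ℝ → ℝ → ℝ} {K L : NNReal}
    (hlip : ∀ t, LipschitzWith K (f t)) (hcont : ∀ x, Continuous fun t => f t x)
    (hbd : ∀ t x, ‖f t x‖ ≤ L) (x₀ : ℝ) :
    ∃ φ : ℝ → ℝ, φ 0 = x₀ ∧ ∀ t, HasDerivAt φ (f t (φ t)) t := by
  have h1 : ∀ N : ℕ, ∃ φ : ℝ → ℝ, φ 0 = x₀ ∧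
      ∀ t ∈ Ioo (-(N : ℝ) - 1) (N + 1), HasDerivAt φ (f t (φ t)) t := by
    intro N
    have h0 : (0 : ℝ) ∈ Icc (-(N : ℝ) - 1) (N + 1) := ⟨by linarith [N.cast_nonneg (α := ℝ)],
      by positivity⟩
    have hP : IsPicardLindelof f (⟨0, h0⟩ : Icc (-(N : ℝ) - 1) (N + 1)) x₀ (L * (N + 1)) 0 L K :=
      { lipschitzOnWith := fun t _ => (hlip t).lipschitzOnWith
        continuousOn := fun x _ => (hcont x).continuousOn
        norm_le := fun t _ x _ => hbd t x
        mul_max_le := by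
          have : max ((N : ℝ) + 1 - 0) (0 - (-(N : ℝ) - 1)) = N + 1 := by
            rw [max_eq_left] <;> linarith
          simp only [this]
          push_cast
          linarith }
    obtain ⟨α, hα0, hα⟩ := hP.exists_eq_forall_mem_Icc_hasDerivWithinAt₀
    exact ⟨α, hα0, fun t ht =>
      (hα t (Ioo_subset_Icc_self ht)).hasDerivAt (Icc_mem_nhds ht.1 ht.2)⟩
  choose φ hφ0 hφ using h1
  have huniq : ∀ M N : ℕ, M ≤ N → EqOn (φ M) (φ N) (Ioo (-(M : ℝ) - 1) (M + 1)) := by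
    intro M N hMN
    have hMN' : (M : ℝ) ≤ N := by exact_mod_cast hMN
    have hM : (0 : ℝ) ≤ M := M.cast_nonneg
    refine ODE_solution_unique_of_mem_Ioo (v := f) (s := fun _ => univ) (K := K) (t₀ := 0)
      (fun t _ => (hlip t).lipschitzOnWith) ⟨by linarith, by linarith⟩
      (fun t ht => ⟨hφ M t ht, trivial⟩)
      (fun t ht => ⟨hφ N t ⟨by linarith [ht.1], by linarith [ht.2]⟩, trivial⟩) ?_
    rw [hφ0, hφ0]
  have hmem : ∀ s : ℝ, s ∈ Ioo (-(⌈|s|⌉₊ : ℝ) - 1) (⌈|s|⌉₊ + 1) := by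
    intro s
    have := Nat.le_ceil |s|
    have h2 := abs_le.1 this
    exact ⟨by linarith [h2.1], by linarith [h2.2]⟩
  have heq : ∀ N : ℕ, ∀ s ∈ Ioo (-(N : ℝ) - 1) (N + 1), φ ⌈|s|⌉₊ s = φ N s := by
    intro N s hs
    rcases le_total ⌈|s|⌉₊ N with h | h
    · exact huniq _ _ h (hmem s)
    · exact (huniq _ _ h hs).symm
  refine ⟨fun s => φ ⌈|s|⌉₊ s, by simp [hφ0], fun t => ?_⟩
  refine (hφ ⌈|t|⌉₊ t (hmem t)).congr_of_eventuallyEq ?_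
  filter_upwards [Ioo_mem_nhds (hmem t).1 (hmem t).2] with s hs
  exact heq _ s hs

/-- Solutions of `y'' = (q - 1) y` for bounded continuous `q`, through Prüfer variables. -/
theorem exists_solution_of_bounded_potential {q : ℝ → ℝ} (hq : Continuous q) {K : ℝ}
    (hK : ∀ t, |q t| ≤ K) (x₀ : ℝ) :
    ∃ y z : ℝ → ℝ, y 0 = sin x₀ ∧ z 0 = cos x₀ ∧ (∀ t, HasDerivAt y (z t) t) ∧
      ∀ t, HasDerivAt z ((q t - 1) * y t) t := by
  have hK0 : 0 ≤ K := (abs_nonneg _).trans (hK 0)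
  obtain ⟨φ, hφ0, hφ⟩ := exists_forall_hasDerivAt_of_lipschitz_of_bounded
    (f := fun t x => 1 - q t * sin x ^ 2) (K := (2 * K).toNNReal) (L := (1 + K).toNNReal)
    (by
      intro t
      refine lipschitzWith_of_nnnorm_deriv_le (by fun_prop) fun x => ?_
      have hd : HasDerivAt (fun x => 1 - q t * sin x ^ 2) (-(q t * (2 * sin x * cos x))) x := by
        have := (((hasDerivAt_sin x).pow 2).const_mul (q t)).const_sub 1
        convert! this using 1
        ring
      rw [hd.deriv, ← NNReal.coe_le_coe, coe_nnnorm, Real.coe_toNNReal _ (by positivity),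
        ← sin_two_mul, norm_neg, norm_mul, Real.norm_eq_abs, Real.norm_eq_abs]
      have := abs_sin_le_one (2 * x)
      nlinarith [hK t, abs_nonneg (q t), abs_nonneg (sin (2 * x))])
    (fun x => by fun_prop)
    (by
      intro t x
      rw [Real.coe_toNNReal _ (by positivity), Real.norm_eq_abs]
      have h1 : sin x ^ 2 ≤ 1 := sin_sq_le_one x
      have h2 := abs_le.1 (hK t)
      rw [abs_le]
      constructor <;> nlinarith [sq_nonneg (sin x)]) x₀
  have hφc : Continuous φ := continuous_iff_continuousAt.2 fun t => (hφ t).continuousAt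
  have hg : Continuous fun t => q t * sin (φ t) * cos (φ t) := by fun_prop
  set R : ℝ → ℝ := fun t => exp (∫ s in (0 : ℝ)..t, q s * sin (φ s) * cos (φ s)) with hR
  have hRd : ∀ t, HasDerivAt R (R t * (q t * sin (φ t) * cos (φ t))) t := fun t =>
    (hg.integral_hasStrictDerivAt 0 t).hasDerivAt.exp
  refine ⟨fun t => R t * sin (φ t), fun t => R t * cos (φ t), by simp [hR, hφ0],
    by simp [hR, hφ0], fun t => ?_, fun t => ?_⟩
  · convert! (hRd t).mul (hφ t).sin using 1
    ring
  · convert! (hRd t).mul (hφ t).cos using 1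
    linear_combination -(R t * q t * sin (φ t)) * sin_sq_add_cos_sq (φ t)

/-- The squared modulus `P = y₁² + y₂²` of a fundamental system of `y'' = (q - 1) y`, where
`q r = κ / r ^ 2` for `r ≥ 1 / 4`, satisfies Ermakov's equation and is bounded above and below. -/
theorem exists_modulus_sq (κ : ℝ) :
    ∃ (P P' : ℝ → ℝ) (C : ℝ), 0 < C ∧ (∀ r, 0 < P r) ∧ (∀ r, HasDerivAt P (P' r) r) ∧
      (∀ r, 1 / 4 ≤ r → HasDerivAt P'
        ((2 + P' r ^ 2 / 2) / P r + 2 * (κ / r ^ 2 - 1) * P r) r) ∧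
      ∀ r, 1 / 4 ≤ r → 1 / C ≤ P r ∧ P r ≤ C := by
  set q : ℝ → ℝ := fun r => κ / (max r (1 / 4)) ^ 2 with hq
  have hmax : ∀ r : ℝ, 1 / 4 ≤ max r (1 / 4) := fun r => le_max_right _ _
  have hmax0 : ∀ r : ℝ, 0 < max r (1 / 4) := fun r => lt_of_lt_of_le (by norm_num) (hmax r)
  have hqc : Continuous q := by
    refine continuous_const.div (by fun_prop) fun r => ?_
    have := hmax0 r
    positivity
  have hqK : ∀ t, |q t| ≤ 16 * |κ| := by
    intro t
    rw [hq, abs_div, abs_of_nonneg (sq_nonneg (max t (1 / 4))), div_le_iff₀ (by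
      have := hmax0 t; positivity)]
    have : (1 / 16 : ℝ) ≤ (max t (1 / 4)) ^ 2 := by nlinarith [hmax t]
    nlinarith [abs_nonneg κ]
  have hq' : ∀ r, 1 / 4 ≤ r → q r = κ / r ^ 2 := by
    intro r hr
    simp only [hq, max_eq_left hr]
  obtain ⟨y₁, z₁, hy10, hz10, hy1, hz1⟩ := exists_solution_of_bounded_potential hqc hqK 0
  obtain ⟨y₂, z₂, hy20, hz20, hy2, hz2⟩ := exists_solution_of_bounded_potential hqc hqK (π / 2)
  have hW : ∀ r, y₁ r * z₂ r - y₂ r * z₁ r = -1 := by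
    have hd : ∀ r, HasDerivAt (fun r => y₁ r * z₂ r - y₂ r * z₁ r) 0 r := by
      intro r
      convert! ((hy1 r).mul (hz2 r)).sub ((hy2 r).mul (hz1 r)) using 1
      ring
    intro r
    have := is_const_of_deriv_eq_zero (fun r => (hd r).differentiableAt) (fun r => (hd r).deriv) r 0
    simpa [hy10, hz10, hy20, hz20] using this
  set P : ℝ → ℝ := fun r => y₁ r ^ 2 + y₂ r ^ 2 with hP
  set Z : ℝ → ℝ := fun r => z₁ r ^ 2 + z₂ r ^ 2 with hZ
  have hPZ : ∀ r, P r * Z r = 1 + (y₁ r * z₁ r + y₂ r * z₂ r) ^ 2 := by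
    intro r
    simp only [hP, hZ]
    linear_combination (y₁ r * z₂ r - y₂ r * z₁ r - 1) * hW r
  have hP0 : ∀ r, 0 < P r := by
    intro r
    have h0 : 0 ≤ P r := by positivity
    rcases h0.lt_or_eq with h | h
    · exact h
    · have := hPZ r
      rw [← h] at this
      nlinarith [sq_nonneg (y₁ r * z₁ r + y₂ r * z₂ r)]
  have hSd : ∀ r, HasDerivAt (fun r => P r + Z r) (2 * q r * (y₁ r * z₁ r + y₂ r * z₂ r)) r := by
    intro r
    convert! (((hy1 r).pow 2).add ((hy2 r).pow 2)).add (((hz1 r).pow 2).add ((hz2 r).pow 2)) using 1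
    ring
  have hanti : AntitoneOn (fun r => (P r + Z r) * exp (|κ| / r)) (Ici (1 / 4)) := by
    have hd : ∀ r : ℝ, 1 / 4 ≤ r → HasDerivAt (fun r => (P r + Z r) * exp (|κ| / r))
        (exp (|κ| / r) * (2 * q r * (y₁ r * z₁ r + y₂ r * z₂ r)
          - |κ| / r ^ 2 * (P r + Z r))) r := by
      intro r hr
      have hr0 : r ≠ 0 := by linarith
      have h1 : HasDerivAt (fun r : ℝ => |κ| / r) (-(|κ| / r ^ 2)) r := by
        convert! (hasDerivAt_inv hr0).const_mul |κ| using 1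
        ring
      convert! (hSd r).mul h1.exp using 1
      ring
    refine antitoneOn_of_deriv_nonpos (convex_Ici _)
      (fun r hr => (hd r hr).continuousAt.continuousWithinAt)
      (fun r hr => (hd r (interior_subset hr)).differentiableAt.differentiableWithinAt)
      fun r hr => ?_
    have hr' : 1 / 4 ≤ r := interior_subset hr
    rw [(hd r hr').deriv]
    refine mul_nonpos_of_nonneg_of_nonpos (exp_pos _).le ?_
    have hq1 : |q r| = |κ| / r ^ 2 := by rw [hq' r hr', abs_div, abs_of_nonneg (sq_nonneg r)]
    have h2 : |2 * (y₁ r * z₁ r + y₂ r * z₂ r)| ≤ P r + Z r := by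
      simp only [hP, hZ]
      rw [abs_le]
      constructor
      · nlinarith [sq_nonneg (y₁ r + z₁ r), sq_nonneg (y₂ r + z₂ r)]
      · nlinarith [sq_nonneg (y₁ r - z₁ r), sq_nonneg (y₂ r - z₂ r)]
    have h3 : q r * (2 * (y₁ r * z₁ r + y₂ r * z₂ r)) ≤ |q r| * (P r + Z r) :=
      (le_abs_self _).trans (by rw [abs_mul]; gcongr)
    rw [← hq1]
    linarith
  set C : ℝ := (P (1 / 4) + Z (1 / 4)) * exp (|κ| / (1 / 4)) with hC
  have hZ0 : ∀ r, 0 ≤ Z r := fun r => by positivity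
  have hC0 : 0 < C := mul_pos (by linarith [hP0 (1 / 4), hZ0 (1 / 4)]) (exp_pos _)
  have hSC : ∀ r, 1 / 4 ≤ r → P r + Z r ≤ C := by
    intro r hr
    refine le_trans ?_ (hanti (mem_Ici.2 le_rfl) hr hr)
    refine le_mul_of_one_le_right (by linarith [hP0 r, hZ0 r]) (one_le_exp ?_)
    have : 0 < r := by linarith
    positivity
  refine ⟨P, fun r => 2 * (y₁ r * z₁ r + y₂ r * z₂ r), C, hC0, hP0, fun r => ?_, fun r hr => ?_,
    fun r hr => ⟨?_, ?_⟩⟩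
  · convert! ((hy1 r).pow 2).add ((hy2 r).pow 2) using 1
    ring
  · have h1 : HasDerivAt (fun r => 2 * (y₁ r * z₁ r + y₂ r * z₂ r))
        (2 * Z r + 2 * (q r - 1) * P r) r := by
      convert! (((hy1 r).mul (hz1 r)).add ((hy2 r).mul (hz2 r))).const_mul 2 using 1
      simp only [hP, hZ]
      ring
    convert! h1 using 1
    rw [← hq' r hr]
    have := (hP0 r).ne'
    field_simp
    linear_combination (-2) * hPZ r + (y₁ r * z₂ r - y₂ r * z₁ r - 1) * hW r
  · rw [div_le_iff₀ hC0]
    nlinarith [hSC r hr, hP0 r, hZ0 r, hPZ r, sq_nonneg (y₁ r * z₁ r + y₂ r * z₂ r)]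
  · linarith [hSC r hr, hZ0 r]

/-- Picone's inequality: a positive solution of `(w u')' = -μ w u` bounds the weighted energy of
functions vanishing at the endpoints. -/
theorem integral_energy_nonneg_of_pos_solution {w u u' h h' : ℝ → ℝ} {α β μ : ℝ} (hαβ : α ≤ β)
    (hw : ContinuousOn w (Icc α β)) (hw0 : ∀ r ∈ Icc α β, 0 ≤ w r)
    (hu : ∀ r ∈ Icc α β, HasDerivAt u (u' r) r) (huc : ContinuousOn u' (Icc α β))
    (hp : ∀ r ∈ Icc α β, HasDerivAt (fun r => w r * u' r) (-(μ * w r * u r)) r)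
    (hpos : ∀ r ∈ Icc α β, 0 < u r)
    (hh : ∀ r, HasDerivAt h (h' r) r) (hhc : Continuous h') (hα : h α = 0) (hβ : h β = 0) :
    0 ≤ ∫ r in α..β, w r * (h' r ^ 2 - μ * h r ^ 2) := by
  have hhc0 : Continuous h := continuous_iff_continuousAt.2 fun r => (hh r).continuousAt
  have huc0 : ContinuousOn u (Icc α β) := fun r hr => (hu r hr).continuousAt.continuousWithinAt
  have hne : ∀ r ∈ Icc α β, u r ≠ 0 := fun r hr => (hpos r hr).ne'
  have hR : ContinuousOn (fun r => w r * (h' r - h r * u' r / u r) ^ 2) (Icc α β) :=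
    hw.mul ((hhc.continuousOn.sub ((hhc0.continuousOn.mul huc).div huc0 hne)).pow 2)
  have hQ : ContinuousOn (fun r => w r * (h' r ^ 2 - μ * h r ^ 2)) (Icc α β) :=
    hw.mul (Continuous.continuousOn (by fun_prop))
  have hRi := hR.intervalIntegrable_of_Icc (μ := volume) hαβ
  have hQi := hQ.intervalIntegrable_of_Icc (μ := volume) hαβ
  have hd : ∀ r ∈ uIcc α β, HasDerivAt (fun r => w r * u' r * h r ^ 2 / u r)
      (w r * (h' r ^ 2 - μ * h r ^ 2) - w r * (h' r - h r * u' r / u r) ^ 2) r := by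
    intro r hr
    rw [uIcc_of_le hαβ] at hr
    have h0 := hne r hr
    convert! ((hp r hr).mul ((hh r).pow 2)).div (hu r hr) h0 using 1
    simp only [Pi.mul_apply, Pi.pow_apply]
    field_simp
    ring
  have := intervalIntegral.integral_eq_sub_of_hasDerivAt hd (hQi.sub hRi)
  rw [intervalIntegral.integral_sub hQi hRi, hα, hβ] at this
  have h2 : 0 ≤ ∫ r in α..β, w r * (h' r - h r * u' r / u r) ^ 2 :=
    intervalIntegral.integral_nonneg hαβ fun r hr => mul_nonneg (hw0 r hr) (sq_nonneg _)
  simp only [ne_eq, OfNat.ofNat_ne_zero, not_false_eq_true, zero_pow, mul_zero, zero_div,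
    sub_zero] at this
  linarith

theorem Real.smoothTransition.deriv_eq_zero_of_one_lt {x : ℝ} (hx : 1 < x) :
    deriv smoothTransition x = 0 := by
  have : smoothTransition =ᶠ[𝓝 x] fun _ => 1 := by
    filter_upwards [Ioi_mem_nhds hx] with y hy
    exact smoothTransition.one_of_one_le (le_of_lt hy)
  rw [this.deriv_eq, deriv_const]

theorem Real.smoothTransition.deriv_eq_zero_of_neg {x : ℝ} (hx : x < 0) :
    deriv smoothTransition x = 0 := by
  have : smoothTransition =ᶠ[𝓝 x] fun _ => 0 := by
    filter_upwards [Iio_mem_nhds hx] with y hy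
    exact smoothTransition.zero_of_nonpos (le_of_lt hy)
  rw [this.deriv_eq, deriv_const]

theorem Real.smoothTransition.continuous_deriv : Continuous (deriv smoothTransition) :=
  (smoothTransition.contDiff (n := 1)).continuous_deriv le_rfl

theorem Real.smoothTransition.exists_abs_deriv_le :
    ∃ M, ∀ x, |deriv smoothTransition x| ≤ M := by
  obtain ⟨M, hM⟩ := isCompact_Icc.exists_bound_of_continuousOn (s := Icc (0 : ℝ) 1)
    smoothTransition.continuous_deriv.continuousOn
  refine ⟨M, fun x => ?_⟩
  by_cases hx : x ∈ Icc (0 : ℝ) 1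
  · exact hM x hx
  · have hM0 : 0 ≤ M := (norm_nonneg _).trans (hM 0 ⟨le_rfl, zero_le_one⟩)
    rw [mem_Icc, not_and_or, not_le, not_le] at hx
    rcases hx with hx | hx
    · rwa [smoothTransition.deriv_eq_zero_of_neg hx, abs_zero]
    · rwa [smoothTransition.deriv_eq_zero_of_one_lt hx, abs_zero]

/-- The weighted Rayleigh quotients of the truncations `u * σ (k * u - 1)` of a positive Dirichlet
solution of `(w u')' = -μ w u` converge to `μ`. -/
theorem tendsto_rayleigh_truncation {w u u' : ℝ → ℝ} {a b μ : ℝ} (hab : a < b)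
    (hw : ContinuousOn w (Icc a b)) (hw0 : ∀ r ∈ Icc a b, 0 < w r)
    (hu : ∀ r ∈ Icc a b, HasDerivAt u (u' r) r) (huc : ContinuousOn u' (Icc a b))
    (hp : ∀ r ∈ Icc a b, HasDerivAt (fun r => w r * u' r) (-(μ * w r * u r)) r)
    (hpos : ∀ r ∈ Ioo a b, 0 < u r) (ha : u a = 0) (hb : u b = 0) :
    (∀ᶠ k : ℕ in atTop, 0 < ∫ r in a..b, w r * (u r * smoothTransition (k * u r - 1)) ^ 2) ∧
    Tendsto (fun k : ℕ => (∫ r in a..b, w r * (u' r * smoothTransition (k * u r - 1)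
        + u r * (deriv smoothTransition (k * u r - 1) * (k * u' r))) ^ 2) /
      ∫ r in a..b, w r * (u r * smoothTransition (k * u r - 1)) ^ 2) atTop (𝓝 μ) := by
  have huc0 : ContinuousOn u (Icc a b) := fun r hr => (hu r hr).continuousAt.continuousWithinAt
  have hσc : ∀ k : ℕ, ContinuousOn (fun r => smoothTransition (k * u r - 1)) (Icc a b) := fun k =>
    smoothTransition.continuous.comp_continuousOn
      ((continuousOn_const.mul huc0).sub continuousOn_const)
  have hσc' : ∀ k : ℕ, ContinuousOn (fun r => deriv smoothTransition (k * u r - 1)) (Icc a b) :=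
    fun k => smoothTransition.continuous_deriv.comp_continuousOn
      ((continuousOn_const.mul huc0).sub continuousOn_const)
  have hσd : ∀ (k : ℕ), ∀ r ∈ Icc a b, HasDerivAt (fun r => smoothTransition (k * u r - 1))
      (deriv smoothTransition (k * u r - 1) * (k * u' r)) r := by
    intro k r hr
    have h1 : HasDerivAt smoothTransition (deriv smoothTransition (k * u r - 1)) (k * u r - 1) :=
      ((smoothTransition.contDiff (n := 1)).differentiable one_ne_zero _).hasDerivAt
    exact h1.comp r (((hu r hr).const_mul (k : ℝ)).sub_const 1)
  have hDc : ∀ k : ℕ, ContinuousOn (fun r => w r * (u r * smoothTransition (k * u r - 1)) ^ 2)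
      (Icc a b) := fun k => hw.mul ((huc0.mul (hσc k)).pow 2)
  have hEc : ∀ k : ℕ, ContinuousOn (fun r => w r *
      (u r * (deriv smoothTransition (k * u r - 1) * (k * u' r))) ^ 2) (Icc a b) := fun k =>
    hw.mul ((huc0.mul ((hσc' k).mul (continuousOn_const.mul huc))).pow 2)
  have hNc : ∀ k : ℕ, ContinuousOn (fun r => w r * (u' r * smoothTransition (k * u r - 1)
      + u r * (deriv smoothTransition (k * u r - 1) * (k * u' r))) ^ 2) (Icc a b) := fun k =>
    hw.mul (((huc.mul (hσc k)).add (huc0.mul ((hσc' k).mul (continuousOn_const.mul huc)))).pow 2)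
  have hiD := fun k => (hDc k).intervalIntegrable_of_Icc (μ := volume) hab.le
  have hiE := fun k => (hEc k).intervalIntegrable_of_Icc (μ := volume) hab.le
  have hiN := fun k => (hNc k).intervalIntegrable_of_Icc (μ := volume) hab.le
  have hkey : ∀ k : ℕ, (∫ r in a..b, w r * (u' r * smoothTransition (k * u r - 1)
        + u r * (deriv smoothTransition (k * u r - 1) * (k * u' r))) ^ 2) =
      μ * (∫ r in a..b, w r * (u r * smoothTransition (k * u r - 1)) ^ 2) +
      ∫ r in a..b, w r * (u r * (deriv smoothTransition (k * u r - 1) * (k * u' r))) ^ 2 := by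
    intro k
    have hd : ∀ r ∈ uIcc a b,
        HasDerivAt (fun r => w r * u' r * (u r * smoothTransition (k * u r - 1) ^ 2))
        (w r * (u' r * smoothTransition (k * u r - 1)
        + u r * (deriv smoothTransition (k * u r - 1) * (k * u' r))) ^ 2 -
        μ * (w r * (u r * smoothTransition (k * u r - 1)) ^ 2) -
        w r * (u r * (deriv smoothTransition (k * u r - 1) * (k * u' r))) ^ 2) r := by
      intro r hr
      rw [uIcc_of_le hab.le] at hr
      convert! (hp r hr).mul ((hu r hr).mul ((hσd k r hr).pow 2)) using 1
      simp only [Pi.mul_apply, Pi.pow_apply]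
      ring
    have := intervalIntegral.integral_eq_sub_of_hasDerivAt hd
      (((hiN k).sub ((hiD k).const_mul μ)).sub (hiE k))
    rw [intervalIntegral.integral_sub ((hiN k).sub ((hiD k).const_mul μ)) (hiE k),
      intervalIntegral.integral_sub (hiN k) ((hiD k).const_mul μ),
      intervalIntegral.integral_const_mul, ha, hb] at this
    linarith
  have hσ1 : ∀ r ∈ Ioo a b, ∀ᶠ k : ℕ in atTop, 2 < (k : ℝ) * u r := by
    intro r hr
    exact (tendsto_natCast_atTop_atTop.atTop_mul_const (hpos r hr)).eventually_gt_atTop 2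
  have hae : ∀ᵐ r ∂volume, r ∈ uIoc a b → r ∈ Ioo a b := by
    have : ∀ᵐ r ∂(volume : Measure ℝ), r ≠ b := by simp [ae_iff]
    filter_upwards [this] with r hr hr2
    rw [uIoc_of_le hab.le] at hr2
    exact ⟨hr2.1, lt_of_le_of_ne hr2.2 hr⟩
  have hD : Tendsto (fun k : ℕ => ∫ r in a..b, w r * (u r * smoothTransition (k * u r - 1)) ^ 2)
      atTop (𝓝 (∫ r in a..b, w r * u r ^ 2)) := by
    refine intervalIntegral.tendsto_integral_filter_of_dominated_convergence
      (fun r => w r * u r ^ 2) (Eventually.of_forall fun k => (hiD k).def'.aestronglyMeasurable)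
      (Eventually.of_forall fun k => ?_)
      ((hw.mul (huc0.pow 2)).intervalIntegrable_of_Icc hab.le) ?_
    · refine Eventually.of_forall fun r hr => ?_
      rw [uIoc_of_le hab.le] at hr
      have h0 := hw0 r (Ioc_subset_Icc_self hr)
      rw [Real.norm_of_nonneg (by positivity)]
      have h1 := smoothTransition.nonneg (k * u r - 1)
      have h2 := smoothTransition.le_one (k * u r - 1)
      rw [mul_pow]
      gcongr
      exact mul_le_of_le_one_right (sq_nonneg _) (pow_le_one₀ h1 h2)
    · filter_upwards [hae] with r hr hr2
      refine tendsto_const_nhds.congr' ?_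
      filter_upwards [hσ1 r (hr hr2)] with k hk
      rw [smoothTransition.one_of_one_le (by linarith), mul_one]
  have hE : Tendsto (fun k : ℕ => ∫ r in a..b, w r *
      (u r * (deriv smoothTransition (k * u r - 1) * (k * u' r))) ^ 2) atTop (𝓝 0) := by
    obtain ⟨M, hM⟩ := smoothTransition.exists_abs_deriv_le
    have hM0 : 0 ≤ M := (abs_nonneg _).trans (hM 0)
    have : (0 : ℝ) = ∫ r in a..b, (0 : ℝ) := by simp
    rw [this]
    refine intervalIntegral.tendsto_integral_filter_of_dominated_convergence
      (fun r => w r * (2 * M * |u' r|) ^ 2)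
      (Eventually.of_forall fun k => (hiE k).def'.aestronglyMeasurable)
      (Eventually.of_forall fun k => ?_)
      ((hw.mul ((continuousOn_const.mul huc.abs).pow 2)).intervalIntegrable_of_Icc hab.le) ?_
    · filter_upwards [hae] with r hr hr2
      have h0 := hw0 r (Ioo_subset_Icc_self (hr hr2))
      have hu0 := hpos r (hr hr2)
      rw [Real.norm_of_nonneg (by positivity)]
      refine mul_le_mul_of_nonneg_left ?_ h0.le
      rw [← sq_abs (u r * _)]
      gcongr
      have h3 : |u r * (deriv smoothTransition (k * u r - 1) * (k * u' r))| =
          (k * u r) * |deriv smoothTransition (k * u r - 1)| * |u' r| := by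
        rw [abs_mul, abs_mul, abs_mul, abs_of_pos hu0, abs_of_nonneg (k.cast_nonneg (α := ℝ))]
        ring
      rw [h3]
      refine mul_le_mul_of_nonneg_right ?_ (abs_nonneg _)
      rcases le_or_gt ((k : ℝ) * u r) 2 with h | h
      · exact mul_le_mul h (hM _) (abs_nonneg _) zero_le_two
      · rw [smoothTransition.deriv_eq_zero_of_one_lt (by linarith), abs_zero, mul_zero]
        positivity
    · filter_upwards [hae] with r hr hr2
      refine tendsto_const_nhds.congr' ?_
      filter_upwards [hσ1 r (hr hr2)] with k hk
      rw [smoothTransition.deriv_eq_zero_of_one_lt (by linarith)]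
      simp
  have hD0 : 0 < ∫ r in a..b, w r * u r ^ 2 :=
    intervalIntegral.intervalIntegral_pos_of_pos_on
      ((hw.mul (huc0.pow 2)).intervalIntegrable_of_Icc hab.le)
      (fun r hr => mul_pos (hw0 r (Ioo_subset_Icc_self hr)) (pow_pos (hpos r hr) 2)) hab
  have hev := hD.eventually_const_lt hD0
  refine ⟨hev, ?_⟩
  have hlim := (tendsto_const_nhds (x := μ)).add (hE.div hD hD0.ne')
  rw [zero_div, add_zero] at hlim
  refine hlim.congr' ?_
  filter_upwards [hev] with k hk
  rw [hkey k, Pi.div_apply, add_div, mul_div_cancel_right₀ _ hk.ne']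

/-- A function whose weighted integral along every ray is nonnegative has nonnegative integral. -/
theorem integral_nonneg_of_forall_ray {E : Type*} [NormedAddCommGroup E] [NormedSpace ℝ E]
    [FiniteDimensional ℝ E] [Nontrivial E] [MeasurableSpace E] [BorelSpace E] (μ : Measure E)
    [μ.IsAddHaarMeasure] {F : E → ℝ} (hF : Integrable F μ)
    (h : ∀ ω : E, ‖ω‖ = 1 →
      0 ≤ ∫ r in Ioi (0 : ℝ), r ^ (Module.finrank ℝ E - 1) * F (r • ω)) :
    0 ≤ ∫ x, F x ∂μ := by
  have hmp := μ.measurePreserving_homeomorphUnitSphereProd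
  have hme := (homeomorphUnitSphereProd E).measurableEmbedding
  set G : Metric.sphere (0 : E) 1 × Ioi (0 : ℝ) → ℝ := fun p => F (p.2.1 • p.1.1) with hG
  have hGF : ∀ x : ({0}ᶜ : Set E), G (homeomorphUnitSphereProd E x) = F x := by
    intro x
    have := congrArg Subtype.val ((homeomorphUnitSphereProd E).symm_apply_apply x)
    simp only [hG]
    rw [← homeomorphUnitSphereProd_symm_apply_coe, this]
  have h1 : ∫ x, F x ∂μ = ∫ p, G p ∂(μ.toSphere.prod (.volumeIoiPow (Module.finrank ℝ E - 1))) := by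
    rw [← hmp.integral_comp hme G]
    simp_rw [hGF]
    rw [integral_subtype_comap (measurableSet_singleton _).compl F, restrict_compl_singleton]
  have hGi : Integrable G (μ.toSphere.prod (.volumeIoiPow (Module.finrank ℝ E - 1))) := by
    rw [← hmp.integrable_comp_emb hme]
    have : G ∘ homeomorphUnitSphereProd E = F ∘ Subtype.val := funext hGF
    rw [this, ← integrableOn_iff_comap_subtypeVal (measurableSet_singleton _).compl]
    exact hF.integrableOn
  rw [h1, integral_prod _ hGi]
  refine integral_nonneg fun ω => ?_
  have := h ω.1 (by simp)
  simp only [Measure.volumeIoiPow, ENNReal.ofReal]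
  rw [integral_withDensity_eq_integral_smul
    ((measurable_subtype_coe.pow_const _).real_toNNReal),
    integral_subtype_comap measurableSet_Ioi
      fun r => Real.toNNReal (r ^ (Module.finrank ℝ E - 1)) • F (r • ω.1)]
  rw [setIntegral_congr_fun measurableSet_Ioi
    (g := fun r => r ^ (Module.finrank ℝ E - 1) * F (r • ω.1)) fun r hr => ?_]
  · exact this
  · simp only
    rw [NNReal.smul_def, Real.coe_toNNReal _ (pow_nonneg (le_of_lt hr) _), smul_eq_mul]

/-- A compact set of reals inside an open interval lies in the interior of a smaller compact
interval. -/
theorem IsCompact.exists_subset_Ioo_of_subset_Ioo {K : Set ℝ} (hK : IsCompact K) {a b : ℝ}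
    (hab : a < b) (h : K ⊆ Ioo a b) : ∃ α β, a < α ∧ α < β ∧ β < b ∧ K ⊆ Ioo α β := by
  rcases K.eq_empty_or_nonempty with rfl | hne
  · exact ⟨(2 * a + b) / 3, (a + 2 * b) / 3, by linarith, by linarith, by linarith,
      empty_subset _⟩
  · obtain ⟨x, hx, hx'⟩ := hK.exists_isLeast hne
    obtain ⟨y, hy, hy'⟩ := hK.exists_isGreatest hne
    have h1 := h hx
    have h2 := h hy
    have h3 := hx' hy
    refine ⟨(a + x) / 2, (y + b) / 2, by linarith [h1.1], by linarith [h1.1, h2.2],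
      by linarith [h2.2], fun z hz => ⟨?_, ?_⟩⟩
    · linarith [hx' hz, h1.1]
    · linarith [hy' hz, h2.2]

theorem ContDiff.integrable_norm_fderiv_sq_of_hasCompactSupport {E : Type*} [NormedAddCommGroup E]
    [NormedSpace ℝ E] [MeasurableSpace E] [BorelSpace E] (μ : Measure E)
    [IsFiniteMeasureOnCompacts μ] {f : E → ℝ} (hf : ContDiff ℝ 1 f) (hfc : HasCompactSupport f) :
    Integrable (fun x => ‖fderiv ℝ f x‖ ^ 2) μ := by
  have h1 : Continuous fun x => ‖fderiv ℝ f x‖ := (hf.continuous_fderiv one_ne_zero).norm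
  have h2 : HasCompactSupport fun x => ‖fderiv ℝ f x‖ := (hfc.fderiv ℝ).norm
  have h3 : Continuous fun x => ‖fderiv ℝ f x‖ ^ 2 := h1.pow 2
  exact h3.integrable_of_hasCompactSupport (h2.comp_left (g := fun y : ℝ => y ^ 2) (by simp))

/-- A positive radial solution `u` of `-Δ u = lam u` on an annulus gives a lower bound for the
Dirichlet energy of functions compactly supported in the annulus. -/
theorem mul_integral_sq_le_integral_norm_fderiv_sq {E : Type*} [NormedAddCommGroup E]
    [NormedSpace ℝ E] [FiniteDimensional ℝ E] [Nontrivial E] [MeasurableSpace E] [BorelSpace E]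
    (μ : Measure E) [μ.IsAddHaarMeasure] {a b lam : ℝ} (ha : 0 ≤ a) (hab : a < b) {u u' : ℝ → ℝ}
    (hu : ∀ r ∈ Ioo a b, HasDerivAt u (u' r) r) (huc : ContinuousOn u' (Ioo a b))
    (hp : ∀ r ∈ Ioo a b, HasDerivAt (fun r => r ^ (Module.finrank ℝ E - 1) * u' r)
      (-(lam * r ^ (Module.finrank ℝ E - 1) * u r)) r)
    (hpos : ∀ r ∈ Ioo a b, 0 < u r) {f : E → ℝ} (hf : ContDiff ℝ 1 f)
    (hfc : HasCompactSupport f) (hfs : ∀ x ∈ tsupport f, ‖x‖ ∈ Ioo a b) :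
    lam * ∫ x, f x ^ 2 ∂μ ≤ ∫ x, ‖fderiv ℝ f x‖ ^ 2 ∂μ := by
  have hfd : Continuous (fderiv ℝ f) := hf.continuous_fderiv one_ne_zero
  have hi1 : Integrable (fun x => f x ^ 2) μ :=
    have hf2 : Continuous fun x => f x ^ 2 := hf.continuous.pow 2
    hf2.integrable_of_hasCompactSupport (hfc.comp_left (g := fun y : ℝ => y ^ 2) (by simp))
  have hi2 : Integrable (fun x => ‖fderiv ℝ f x‖ ^ 2) μ :=
    hf.integrable_norm_fderiv_sq_of_hasCompactSupport μ hfc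
  obtain ⟨α, β, haα, hαβ, hβb, hK⟩ :=
    (hfc.isCompact.image continuous_norm).exists_subset_Ioo_of_subset_Ioo hab
      (by rintro _ ⟨x, hx, rfl⟩; exact hfs x hx)
  have hf0 : ∀ x, ‖x‖ ∉ Ioo α β → f x = 0 := fun x hx =>
    image_eq_zero_of_notMem_tsupport fun h => hx (hK ⟨x, h, rfl⟩)
  have hfd0 : ∀ x, ‖x‖ ∉ Ioo α β → fderiv ℝ f x = 0 := fun x hx => by
    by_contra h
    exact hx (hK ⟨x, support_fderiv_subset ℝ h, rfl⟩)
  have hsub : Icc α β ⊆ Ioo a b := fun r hr => ⟨haα.trans_le hr.1, hr.2.trans_lt hβb⟩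
  have key : 0 ≤ ∫ x, (‖fderiv ℝ f x‖ ^ 2 - lam * f x ^ 2) ∂μ := by
    refine integral_nonneg_of_forall_ray μ (hi2.sub (hi1.const_mul lam)) fun ω hω => ?_
    set d := Module.finrank ℝ E - 1
    have hline : ∀ r : ℝ, HasDerivAt (fun r : ℝ => r • ω) ω r := fun r => by
      simpa using (hasDerivAt_id r).smul_const ω
    have hlc : Continuous fun r : ℝ => r • ω := continuous_id.smul continuous_const
    have hnorm : ∀ r : ℝ, 0 < r → ‖r • ω‖ = r := fun r hr => by
      rw [norm_smul, hω, mul_one, Real.norm_of_nonneg hr.le]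
    have hα0 : 0 < α := ha.trans_lt haα
    rw [setIntegral_eq_of_subset_of_forall_sdiff_eq_zero (s := Ioc α β) measurableSet_Ioi
      (fun r hr => hα0.trans hr.1), ← intervalIntegral.integral_of_le hαβ.le]
    · refine (integral_energy_nonneg_of_pos_solution (w := fun r => r ^ d)
        (h := fun r => f (r • ω)) (h' := fun r => fderiv ℝ f (r • ω) ω) hαβ.le
        (continuous_pow d).continuousOn (fun r hr => pow_nonneg (hα0.le.trans hr.1) d)
        (fun r hr => hu r (hsub hr)) (huc.mono hsub) (fun r hr => hp r (hsub hr))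
        (fun r hr => hpos r (hsub hr)) (fun r => ?_) ?_ ?_ ?_).trans ?_
      · exact ((hf.differentiable one_ne_zero _).hasFDerivAt).comp_hasDerivAt r (hline r)
      · exact (hfd.comp hlc).clm_apply continuous_const
      · exact hf0 _ (by rw [hnorm α hα0]; simp)
      · exact hf0 _ (by rw [hnorm β (hα0.trans hαβ)]; simp)
      · refine intervalIntegral.integral_mono_on hαβ.le ?_ ?_ fun r hr => ?_
        · refine Continuous.intervalIntegrable ?_ _ _
          exact (continuous_pow d).mul ((((hfd.comp hlc).clm_apply continuous_const).pow 2).sub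
            (continuous_const.mul ((hf.continuous.comp hlc).pow 2)))
        · refine Continuous.intervalIntegrable ?_ _ _
          exact (continuous_pow d).mul (((hfd.comp hlc).norm.pow 2).sub
            (continuous_const.mul ((hf.continuous.comp hlc).pow 2)))
        · refine mul_le_mul_of_nonneg_left ?_ (pow_nonneg (hα0.le.trans hr.1) d)
          refine sub_le_sub_right ?_ _
          have := (fderiv ℝ f (r • ω)).le_opNorm ω
          rw [hω, mul_one] at this
          rw [← sq_abs]
          exact pow_le_pow_left₀ (abs_nonneg _) this 2
    · intro r hr
      have hr' : ‖r • ω‖ ∉ Ioo α β := by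
        rw [hnorm r hr.1]
        exact fun h => hr.2 (Ioo_subset_Ioc_self h)
      rw [hf0 _ hr', hfd0 _ hr']
      simp
  rw [integral_sub hi2 (hi1.const_mul lam), integral_const_mul] at key
  linarith

/-- Radial profiles give test functions for the first Dirichlet eigenvalue of an annulus. -/
theorem exists_test_function_of_radial {n : ℕ} (hn : 2 ≤ n) {a b : ℝ} (ha : 0 ≤ a)
    {φ : ℝ → ℝ} (hφ : ContDiff ℝ (⊤ : ℕ∞) φ) (hφs : tsupport φ ⊆ Ioo a b)
    (hpos : 0 < ∫ r in a..b, r ^ (n - 1) * φ r ^ 2) :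
    ∃ f : EuclideanSpace ℝ (Fin n) → ℝ, ContDiff ℝ (⊤ : ℕ∞) f ∧ HasCompactSupport f ∧
      tsupport f ⊆ annulus n a b ∧ f ≠ 0 ∧ (∫ x, ‖fderiv ℝ f x‖ ^ 2) / (∫ x, (f x) ^ 2) ≤
      (∫ r in a..b, r ^ (n - 1) * deriv φ r ^ 2) / ∫ r in a..b, r ^ (n - 1) * φ r ^ 2 := by
  set E := EuclideanSpace ℝ (Fin n)
  have : NeZero n := ⟨by omega⟩
  have hfin : Module.finrank ℝ E = n := finrank_euclideanSpace_fin
  have hab : a ≤ b := by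
    by_contra! h
    have : φ = 0 := by
      rw [← tsupport_eq_empty_iff, ← subset_empty_iff]
      simpa [Ioo_eq_empty_of_le h.le] using hφs
    simp [this] at hpos
  have hφ0 : ∀ r, r ∉ Ioo a b → φ r = 0 := fun r hr =>
    image_eq_zero_of_notMem_tsupport fun h => hr (hφs h)
  have hφd0 : ∀ r, r ∉ Ioo a b → deriv φ r = 0 := fun r hr => by
    by_contra h
    exact hr (hφs (support_deriv_subset h))
  set f : E → ℝ := fun x => φ ‖x‖ with hf
  have hts : ∀ x ∈ tsupport f, ‖x‖ ∈ tsupport φ := fun x hx =>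
    (closure_minimal (fun y hy => subset_tsupport φ hy : Function.support f ⊆ norm ⁻¹' tsupport φ)
      ((isClosed_tsupport φ).preimage continuous_norm)) hx
  have hzero : f =ᶠ[𝓝 0] 0 := by
    rw [← notMem_tsupport_iff_eventuallyEq]
    intro h
    have := (hφs (hts 0 h)).1
    rw [norm_zero] at this
    linarith
  have hφdiff : Differentiable ℝ φ := hφ.differentiable (by simp)
  have hfsm : ContDiff ℝ (⊤ : ℕ∞) f := by
    rw [contDiff_iff_contDiffAt]
    intro x
    rcases eq_or_ne x 0 with rfl | hx
    · exact contDiffAt_const.congr_of_eventuallyEq hzero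
    · exact hφ.contDiffAt.comp x (contDiffAt_norm ℝ hx)
  have hfcs : HasCompactSupport f := by
    refine (isCompact_closedBall (0 : E) b).of_isClosed_subset (isClosed_tsupport f) fun x hx => ?_
    rw [mem_closedBall_zero_iff]
    exact (hφs (hts x hx)).2.le
  have hfd : ∀ x, ‖fderiv ℝ f x‖ ^ 2 ≤ deriv φ ‖x‖ ^ 2 := by
    intro x
    rcases eq_or_ne x 0 with rfl | hx
    · rw [hzero.fderiv_eq]
      simp [sq_nonneg]
    · have h1 : HasFDerivAt f (deriv φ ‖x‖ • fderiv ℝ (fun y : E => ‖y‖) x) x :=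
        (hφdiff ‖x‖).hasDerivAt.comp_hasFDerivAt x
          ((contDiffAt_norm (n := 1) ℝ hx).differentiableAt one_ne_zero).hasFDerivAt
      rw [h1.fderiv, norm_smul, mul_pow, Real.norm_eq_abs, sq_abs]
      have h2 : ‖fderiv ℝ (fun y : E => ‖y‖) x‖ ≤ 1 := by
        simpa using norm_fderiv_le_of_lipschitz ℝ (x₀ := x) (lipschitzWith_one_norm (E := E))
      exact mul_le_of_le_one_right (sq_nonneg _) (pow_le_one₀ (norm_nonneg _) h2)
  have hφcs : HasCompactSupport φ :=
    isCompact_Icc.of_isClosed_subset (isClosed_tsupport φ) (hφs.trans Ioo_subset_Icc_self)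
  have hφdc : Continuous (deriv φ) := hφ.continuous_deriv (by simp)
  have hpolar : ∀ ψ : ℝ → ℝ, (∀ r, r ∉ Ioo a b → ψ r = 0) →
      ∫ x : E, ψ ‖x‖ = (n * volume.real (Metric.ball (0 : E) 1)) *
        ∫ r in a..b, r ^ (n - 1) * ψ r := by
    intro ψ hψ
    rw [integral_fun_norm_addHaar volume ψ, hfin, nsmul_eq_mul, smul_eq_mul, mul_assoc,
      intervalIntegral.integral_of_le hab,
      setIntegral_eq_of_subset_of_forall_sdiff_eq_zero (s := Ioc a b) measurableSet_Ioi
        fun r hr => ha.trans_lt hr.1]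
    · simp only [smul_eq_mul]
    · intro r hr
      rw [hψ r fun h => hr.2 (Ioo_subset_Ioc_self h), smul_zero]
  have hV : 0 < n * volume.real (Metric.ball (0 : E) 1) := by
    have : 0 < volume.real (Metric.ball (0 : E) 1) :=
      ENNReal.toReal_pos (Metric.measure_ball_pos volume _ one_pos).ne' measure_ball_lt_top.ne
    have : (0 : ℝ) < n := by exact_mod_cast (by omega : 0 < n)
    positivity
  have hD : ∫ x, f x ^ 2 = (n * volume.real (Metric.ball (0 : E) 1)) *
      ∫ r in a..b, r ^ (n - 1) * φ r ^ 2 :=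
    hpolar (fun r => φ r ^ 2) fun r hr => by rw [hφ0 r hr]; simp
  have hN : ∫ x, ‖fderiv ℝ f x‖ ^ 2 ≤ (n * volume.real (Metric.ball (0 : E) 1)) *
      ∫ r in a..b, r ^ (n - 1) * deriv φ r ^ 2 := by
    rw [← hpolar (fun r => deriv φ r ^ 2) fun r hr => by rw [hφd0 r hr]; simp]
    refine integral_mono ?_ ?_ hfd
    · exact (hfsm.of_le (by simp)).integrable_norm_fderiv_sq_of_hasCompactSupport volume hfcs
    · refine ((hφdc.comp continuous_norm).pow 2).integrable_of_hasCompactSupport ?_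
      refine HasCompactSupport.intro (isCompact_closedBall (0 : E) b) fun x hx => ?_
      rw [mem_closedBall_zero_iff] at hx
      simp only [Pi.pow_apply, Function.comp_apply]
      rw [hφd0 _ fun h => hx h.2.le]
      simp
  have hne : f ≠ 0 := by
    intro h
    simp only [h, Pi.zero_apply, ne_eq, OfNat.ofNat_ne_zero, not_false_eq_true, zero_pow,
      integral_zero] at hD
    exact (mul_pos hV hpos).ne hD
  refine ⟨f, hfsm, hfcs, fun x hx => hφs (hts x hx), hne, ?_⟩
  rw [hD, ← mul_div_mul_left (∫ r in a..b, r ^ (n - 1) * deriv φ r ^ 2) _ hV.ne']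
  have := mul_pos hV hpos
  gcongr
/-- Solutions of the radial eigenvalue equation are smooth away from the origin. -/
theorem contDiffOn_of_radial_equation {c μ m : ℝ} (hc : 0 ≤ c) {u u' : ℝ → ℝ}
    (hu : ∀ r, c < r → HasDerivAt u (u' r) r)
    (hu' : ∀ r, c < r → HasDerivAt u' (-(μ * u r) - m / r * u' r) r) :
    ContDiffOn ℝ (⊤ : ℕ∞) u (Ioi c) := by
  have key : ∀ k : ℕ, ContDiffOn ℝ k u (Ioi c) ∧ ContDiffOn ℝ k u' (Ioi c) := by
    intro k
    induction k with
    | zero =>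
      exact ⟨contDiffOn_zero.2 fun r hr => (hu r hr).continuousAt.continuousWithinAt,
        contDiffOn_zero.2 fun r hr => (hu' r hr).continuousAt.continuousWithinAt⟩
    | succ k ih =>
      push_cast
      rw [contDiffOn_succ_iff_deriv_of_isOpen isOpen_Ioi,
        contDiffOn_succ_iff_deriv_of_isOpen isOpen_Ioi]
      refine ⟨⟨fun r hr => (hu r hr).differentiableAt.differentiableWithinAt, by simp,
        ih.2.congr fun r hr => (hu r hr).deriv⟩,
        fun r hr => (hu' r hr).differentiableAt.differentiableWithinAt, by simp, ?_⟩
      refine ContDiffOn.congr (f := fun r => -(μ * u r) - m / r * u' r) ?_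
        fun r hr => (hu' r hr).deriv
      exact (contDiffOn_const.mul ih.1).neg.sub ((contDiffOn_const.div contDiffOn_id
        fun r hr => (hc.trans_lt hr).ne').mul ih.2)
  exact contDiffOn_infty.2 fun k => (key k).1

/-- The truncation of a positive solution is a smooth function compactly supported in the
interval. -/
theorem contDiff_indicator_truncation {a b : ℝ} {u : ℝ → ℝ}
    (hu : ContDiffOn ℝ (⊤ : ℕ∞) u (Ioo a b)) (huc : ContinuousOn u (Icc a b))
    (ha : u a = 0) (hb : u b = 0) (k : ℕ) :
    ContDiff ℝ (⊤ : ℕ∞) ((Ioo a b).indicator fun r => u r * smoothTransition (k * u r - 1)) ∧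
    tsupport ((Ioo a b).indicator fun r => u r * smoothTransition (k * u r - 1)) ⊆ Ioo a b := by
  set φ := (Ioo a b).indicator fun r => u r * smoothTransition (k * u r - 1) with hφ
  set K := Icc a b ∩ u ⁻¹' {y | 1 ≤ k * y} with hK
  have hKc : IsClosed K := huc.preimage_isClosed_of_isClosed isClosed_Icc
    (isClosed_le continuous_const (continuous_const.mul continuous_id))
  have hKsub : K ⊆ Ioo a b := by
    rintro r ⟨hr, hr'⟩
    have h0 : u r ≠ 0 := by
      intro h
      simp only [mem_preimage, mem_ofPred_eq, h] at hr'
      linarith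
    refine ⟨lt_of_le_of_ne hr.1 ?_, lt_of_le_of_ne hr.2 ?_⟩
    · rintro rfl
      exact h0 ha
    · rintro rfl
      exact h0 hb
  have hsupp : Function.support φ ⊆ K := by
    intro r hr
    have hr1 : r ∈ Ioo a b := by
      by_contra h
      exact hr (indicator_of_notMem h _)
    refine ⟨Ioo_subset_Icc_self hr1, ?_⟩
    by_contra h
    simp only [mem_preimage, mem_ofPred_eq, not_le] at h
    refine hr ?_
    rw [hφ, indicator_of_mem hr1, smoothTransition.zero_of_nonpos (by linarith), mul_zero]
  have hts : tsupport φ ⊆ K := closure_minimal hsupp hKc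
  refine ⟨contDiff_iff_contDiffAt.2 fun r => ?_, hts.trans hKsub⟩
  by_cases hr : r ∈ Ioo a b
  · have h1 := (hu r hr).contDiffAt (isOpen_Ioo.mem_nhds hr)
    have h2 : ContDiffAt ℝ (⊤ : ℕ∞) (fun r => u r * smoothTransition (k * u r - 1)) r :=
      h1.mul (smoothTransition.contDiff.contDiffAt.comp r
        ((contDiffAt_const.mul h1).sub contDiffAt_const))
    refine h2.congr_of_eventuallyEq ?_
    filter_upwards [isOpen_Ioo.mem_nhds hr] with s hs
    exact indicator_of_mem hs _
  · have : φ =ᶠ[𝓝 r] 0 := by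
      rw [← notMem_tsupport_iff_eventuallyEq]
      exact fun h => hr (hKsub (hts h))
    exact contDiffAt_const.congr_of_eventuallyEq this

/-- A radial Dirichlet solution of `-Δ u = μ u` that is positive in an annulus realizes the first
Dirichlet eigenvalue. -/
theorem dirichletEigenvalue_annulus_eq {n : ℕ} (hn : 2 ≤ n) {a b c μ : ℝ} (hc : 0 ≤ c)
    (hca : c < a) (hab : a < b) {u u' : ℝ → ℝ} (hu : ∀ r, c < r → HasDerivAt u (u' r) r)
    (hu' : ∀ r, c < r → HasDerivAt u' (-(μ * u r) - (n - 1) / r * u' r) r)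
    (ha : u a = 0) (hb : u b = 0) (hpos : ∀ r ∈ Ioo a b, 0 < u r) :
    dirichletEigenvalue n (annulus n a b) = μ := by
  have hne : NeZero n := ⟨by omega⟩
  have hfin : Module.finrank ℝ (EuclideanSpace ℝ (Fin n)) = n := finrank_euclideanSpace_fin
  have ha0 : 0 ≤ a := hc.trans hca.le
  have hIcc : ∀ r ∈ Icc a b, c < r := fun r hr => hca.trans_le hr.1
  have hp : ∀ r, c < r → HasDerivAt (fun r => r ^ (n - 1) * u' r) (-(μ * r ^ (n - 1) * u r)) r := by
    intro r hr
    have hr0 : r ≠ 0 := (hc.trans_lt hr).ne'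
    convert! (hasDerivAt_pow (n - 1) r).mul (hu' r hr) using 1
    obtain ⟨m, rfl⟩ : ∃ m, n = m + 2 := ⟨n - 2, by omega⟩
    simp only [Nat.add_one_sub_one, Nat.cast_add, Nat.cast_ofNat, Nat.cast_one,
      show m + 2 - 1 = m + 1 from rfl]
    field_simp
    ring
  have huc : ContinuousOn u' (Icc a b) := fun r hr =>
    (hu' r (hIcc r hr)).continuousAt.continuousWithinAt
  have hucu : ContinuousOn u (Icc a b) := fun r hr =>
    (hu r (hIcc r hr)).continuousAt.continuousWithinAt
  have hsm := contDiffOn_of_radial_equation hc hu hu'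
  obtain ⟨hev, hlim⟩ := tendsto_rayleigh_truncation (w := fun r => r ^ (n - 1)) hab
    (continuous_pow (n - 1)).continuousOn (fun r hr => pow_pos (hc.trans_lt (hIcc r hr)) _)
    (fun r hr => hu r (hIcc r hr)) huc (fun r hr => hp r (hIcc r hr)) hpos ha hb
  have hex : ∀ᶠ k : ℕ in atTop, ∃ f : EuclideanSpace ℝ (Fin n) → ℝ, ContDiff ℝ (⊤ : ℕ∞) f ∧
      HasCompactSupport f ∧ tsupport f ⊆ annulus n a b ∧ f ≠ 0 ∧
      (∫ x, ‖fderiv ℝ f x‖ ^ 2) / (∫ x, (f x) ^ 2) ≤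
      (∫ r in a..b, r ^ (n - 1) * (u' r * smoothTransition (k * u r - 1)
        + u r * (deriv smoothTransition (k * u r - 1) * (k * u' r))) ^ 2) /
      ∫ r in a..b, r ^ (n - 1) * (u r * smoothTransition (k * u r - 1)) ^ 2 := by
    filter_upwards [hev] with k hk
    obtain ⟨h1, h2⟩ := contDiff_indicator_truncation
      (hsm.mono fun r hr => hIcc r (Ioo_subset_Icc_self hr)) hucu ha hb k
    have hae : ∀ᵐ r ∂volume, r ∈ uIoc a b → r ∈ Ioo a b := by
      have : ∀ᵐ r ∂(volume : Measure ℝ), r ≠ b := by simp [ae_iff]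
      filter_upwards [this] with r hr hr2
      rw [uIoc_of_le hab.le] at hr2
      exact ⟨hr2.1, lt_of_le_of_ne hr2.2 hr⟩
    have e1 : ∫ r in a..b, r ^ (n - 1) *
        (Ioo a b).indicator (fun r => u r * smoothTransition (k * u r - 1)) r ^ 2 =
        ∫ r in a..b, r ^ (n - 1) * (u r * smoothTransition (k * u r - 1)) ^ 2 := by
      refine intervalIntegral.integral_congr_ae ?_
      filter_upwards [hae] with r hr hr2
      rw [indicator_of_mem (hr hr2)]
    have e2 : ∫ r in a..b, r ^ (n - 1) *
        deriv ((Ioo a b).indicator fun r => u r * smoothTransition (k * u r - 1)) r ^ 2 =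
        ∫ r in a..b, r ^ (n - 1) * (u' r * smoothTransition (k * u r - 1)
          + u r * (deriv smoothTransition (k * u r - 1) * (k * u' r))) ^ 2 := by
      refine intervalIntegral.integral_congr_ae ?_
      filter_upwards [hae] with r hr hr2
      have hr3 := hr hr2
      have hd := hu r (hIcc r (Ioo_subset_Icc_self hr3))
      have hev : ((Ioo a b).indicator fun r => u r * smoothTransition (k * u r - 1)) =ᶠ[𝓝 r]
          fun r => u r * smoothTransition (k * u r - 1) := by
        filter_upwards [isOpen_Ioo.mem_nhds hr3] with s hs
        exact indicator_of_mem hs _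
      have h1 : HasDerivAt smoothTransition (deriv smoothTransition (k * u r - 1))
          (k * u r - 1) :=
        ((smoothTransition.contDiff (n := 1)).differentiable one_ne_zero _).hasDerivAt
      have h2 := hd.mul (h1.comp r ((hd.const_mul (k : ℝ)).sub_const 1))
      rw [hev.deriv_eq]
      congr 2
      exact h2.deriv
    have := exists_test_function_of_radial hn ha0 h1 h2 (by rw [e1]; exact hk)
    rwa [e1, e2] at this
  have hle : ∀ᶠ k : ℕ in atTop, dirichletEigenvalue n (annulus n a b) ≤
      (∫ r in a..b, r ^ (n - 1) * (u' r * smoothTransition (k * u r - 1)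
        + u r * (deriv smoothTransition (k * u r - 1) * (k * u' r))) ^ 2) /
      ∫ r in a..b, r ^ (n - 1) * (u r * smoothTransition (k * u r - 1)) ^ 2 := by
    filter_upwards [hex] with k hk
    obtain ⟨f, hf, hfc, hfs, hf0, hle⟩ := hk
    have h1 : dirichletEigenvalue n (annulus n a b) ≤
        (∫ x, ‖fderiv ℝ f x‖ ^ 2) / ∫ x, f x ^ 2 := by
      refine csInf_le ⟨0, ?_⟩ ⟨f, hf, hfc, hfs, hf0, rfl⟩
      rintro _ ⟨g, -, -, -, -, rfl⟩
      positivity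
    exact h1.trans hle
  refine le_antisymm (ge_of_tendsto hlim hle) ?_
  refine le_csInf ?_ ?_
  · obtain ⟨k, f, hf, hfc, hfs, hf0, -⟩ := hex.exists
    exact ⟨_, f, hf, hfc, hfs, hf0, rfl⟩
  · rintro _ ⟨f, hf, hfc, hfs, hf0, rfl⟩
    have h1 := mul_integral_sq_le_integral_norm_fderiv_sq
      (volume : Measure (EuclideanSpace ℝ (Fin n))) ha0 hab
      (fun r hr => hu r (hIcc r (Ioo_subset_Icc_self hr))) (huc.mono Ioo_subset_Icc_self)
      (lam := μ) (by
        rw [hfin]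
        exact fun r hr => hp r (hIcc r (Ioo_subset_Icc_self hr))) hpos
      (hf.of_le (by simp)) hfc hfs
    rw [le_div_iff₀ ?_]
    · exact h1
    · have hc2 : Continuous fun x => f x ^ 2 := hf.continuous.pow 2
      obtain ⟨x, hx⟩ := Function.ne_iff.1 hf0
      exact hc2.integral_pos_of_hasCompactSupport_nonneg_nonzero
        (hfc.comp_left (g := fun y : ℝ => y ^ 2) (by simp)) (fun x => sq_nonneg _)
        (pow_ne_zero 2 hx)

/-- The solution of `v'' = (κ / r² - 1) v` with modulus squared `P` and phase `θ`. -/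
theorem hasDerivAt_sqrt_mul_sin {P P' θ : ℝ → ℝ} (hP : ∀ r, 0 < P r)
    (hP' : ∀ r, HasDerivAt P (P' r) r) (hθ : ∀ r, HasDerivAt θ (1 / P r) r) (θ₀ r : ℝ) :
    HasDerivAt (fun r => √(P r) * sin (θ r - θ₀))
      (P' r / (2 * √(P r)) * sin (θ r - θ₀) + cos (θ r - θ₀) / √(P r)) r := by
  have hs : √(P r) ≠ 0 := (sqrt_pos.2 (hP r)).ne'
  convert! ((hP' r).sqrt (hP r).ne').mul ((hθ r).sub_const θ₀).sin using 1
  have : P r = √(P r) ^ 2 := (sq_sqrt (hP r).le).symm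
  generalize √(P r) = ρ at *
  rw [this]
  field_simp

theorem hasDerivAt_deriv_sqrt_mul_sin {P P' θ : ℝ → ℝ} {q r : ℝ} (hP : ∀ r, 0 < P r)
    (hP' : ∀ r, HasDerivAt P (P' r) r) (hθ : ∀ r, HasDerivAt θ (1 / P r) r)
    (hP'' : HasDerivAt P' ((2 + P' r ^ 2 / 2) / P r + 2 * q * P r) r) (θ₀ : ℝ) :
    HasDerivAt (fun r => P' r / (2 * √(P r)) * sin (θ r - θ₀) + cos (θ r - θ₀) / √(P r))
      (q * (√(P r) * sin (θ r - θ₀))) r := by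
  have hs : √(P r) ≠ 0 := (sqrt_pos.2 (hP r)).ne'
  have h1 := (hP' r).sqrt (hP r).ne'
  have h2 := ((hθ r).sub_const θ₀)
  convert! ((hP''.div (h1.const_mul 2) (by positivity)).mul h2.sin).add (h2.cos.div h1 hs) using 1
  simp only [Pi.div_apply]
  have : P r = √(P r) ^ 2 := (sq_sqrt (hP r).le).symm
  generalize √(P r) = ρ at *
  rw [this]
  field_simp
  ring

/-- The Liouville substitution turns `v'' = (κ / r² - 1) v` into the radial eigenvalue equation. -/
theorem dirichletEigenvalue_annulus_of_liouville {n : ℕ} (hn : 2 ≤ n) {a b c s : ℝ} (hc : 0 ≤ c)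
    (hca : c < a) (hab : a < b) (hs : 0 < s) {v v' : ℝ → ℝ}
    (hv : ∀ r, c < r → HasDerivAt v (v' r) r)
    (hv' : ∀ r, c < r → HasDerivAt v' (((n - 1) * (n - 3) / 4 / r ^ 2 - 1) * v r) r)
    (ha : v a = 0) (hb : v b = 0) (hpos : ∀ r ∈ Ioo a b, 0 < v r) :
    dirichletEigenvalue n (annulus n (s * a) (s * b)) = 1 / s ^ 2 := by
  set m : ℝ := ((n : ℝ) - 1) / 2 with hm
  have hpow : ∀ r : ℝ, 0 < r → HasDerivAt (fun r : ℝ => r ^ (-m)) (-m / r * r ^ (-m)) r := by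
    intro r hr
    convert! hasDerivAt_rpow_const (p := -m) (Or.inl hr.ne') using 1
    rw [rpow_sub_one hr.ne']
    ring
  have hu : ∀ r, c < r → HasDerivAt (fun r => r ^ (-m) * v r)
      (r ^ (-m) * (v' r - m / r * v r)) r := by
    intro r hr
    convert! (hpow r (hc.trans_lt hr)).mul (hv r hr) using 1
    ring
  have hu' : ∀ r, c < r → HasDerivAt (fun r => r ^ (-m) * (v' r - m / r * v r))
      (-(r ^ (-m) * v r) - (n - 1) / r * (r ^ (-m) * (v' r - m / r * v r))) r := by
    intro r hr
    have hr0 : r ≠ 0 := (hc.trans_lt hr).ne'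
    have h1 : HasDerivAt (fun r => m / r) (-m / r ^ 2) r := by
      convert! (hasDerivAt_inv hr0).const_mul m using 1
      field_simp
    convert! (hpow r (hc.trans_lt hr)).mul ((hv' r hr).sub (h1.mul (hv r hr))) using 1
    simp only [Pi.sub_apply, Pi.mul_apply]
    have hn' : (n : ℝ) = 2 * m + 1 := by rw [hm]; ring
    rw [hn']
    field_simp
    ring
  have hsc : ∀ r, HasDerivAt (fun r => r / s) (1 / s) r := fun r => (hasDerivAt_id r).div_const s
  have hdom : ∀ r, s * c < r → c < r / s := fun r hr => by rwa [lt_div_iff₀' hs]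
  refine dirichletEigenvalue_annulus_eq hn (c := s * c)
    (u := fun r => (r / s) ^ (-m) * v (r / s))
    (u' := fun r => (r / s) ^ (-m) * (v' (r / s) - m / (r / s) * v (r / s)) * (1 / s))
    (by positivity) (by gcongr) (by gcongr)
    (fun r hr => HasDerivAt.comp (h := fun r => r / s) r (hu _ (hdom r hr)) (hsc r)) (fun r hr => ?_) ?_ ?_ ?_
  · have hr0 : r ≠ 0 := ((mul_nonneg hs.le hc).trans_lt hr).ne'
    convert! ((hu' _ (hdom r hr)).comp (h := fun r => r / s) r (hsc r)).mul_const (1 / s) using 1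
    field_simp
  · simp [mul_div_cancel_left₀ _ hs.ne', ha]
  · simp [mul_div_cancel_left₀ _ hs.ne', hb]
  · intro r hr
    have h1 : r / s ∈ Ioo a b := ⟨by rw [lt_div_iff₀' hs]; exact hr.1,
      by rw [div_lt_iff₀' hs]; exact hr.2⟩
    exact mul_pos (rpow_pos_of_pos (hc.trans_lt (hca.trans h1.1)) _) (hpos _ h1)
/-- Increments of a phase `θ` with `θ' = 1 / P`, where `1 / C ≤ P ≤ C` beyond `r₀`. -/
theorem phase_sub_bounds {P θ : ℝ → ℝ} {C r₀ a b : ℝ} (hC : 0 < C)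
    (hP : ∀ r, r₀ ≤ r → 1 / C ≤ P r ∧ P r ≤ C) (hθ : ∀ r, HasDerivAt θ (1 / P r) r)
    (ha : r₀ ≤ a) (hab : a < b) : (b - a) / C ≤ θ b - θ a ∧ θ b - θ a ≤ C * (b - a) := by
  obtain ⟨ξ, hξ, h⟩ := exists_hasDerivAt_eq_slope θ (fun r => 1 / P r) hab
    (fun r _ => (hθ r).continuousAt.continuousWithinAt) fun r _ => hθ r
  have hba : 0 < b - a := sub_pos.2 hab
  rw [eq_div_iff hba.ne'] at h
  obtain ⟨h1, h2⟩ := hP ξ (ha.trans hξ.1.le)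
  have hp : 0 < P ξ := (by positivity : 0 < 1 / C).trans_le h1
  rw [← h]
  constructor
  · rw [div_mul_eq_mul_div, one_mul]
    gcongr
  · gcongr
    rwa [one_div_le hp hC]

/-- The derivative identity behind the energy growth between consecutive zeros of a solution of
`v'' = (κ / r² - 1) v`. -/
theorem hasDerivAt_energy {v v' : ℝ → ℝ} {κ r : ℝ} (hr : r ≠ 0) (hv : HasDerivAt v (v' r) r)
    (hv' : HasDerivAt v' ((κ / r ^ 2 - 1) * v r) r) :
    HasDerivAt (fun r => r * v' r ^ 2 - v r * v' r - (κ / r - r) * v r ^ 2) (2 * v r ^ 2) r := by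
  have h1 : HasDerivAt (fun r => κ / r) (-κ / r ^ 2) r := by
    convert! (hasDerivAt_inv hr).const_mul κ using 1
    field_simp
  convert! (((hasDerivAt_id r).mul (hv'.pow 2)).sub (hv.mul hv')).sub
    ((h1.sub (hasDerivAt_id r)).mul (hv.pow 2)) using 1
  simp only [Pi.pow_apply, Pi.sub_apply, id]
  field_simp
  ring

/-- Growth of `r / P r` between points whose phases differ by `π`. -/
theorem div_modulus_sub_bounds {P P' θ : ℝ → ℝ} {C κ a b : ℝ} (hC : 0 < C) (hP0 : ∀ r, 0 < P r)
    (hP' : ∀ r, HasDerivAt P (P' r) r)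
    (hP'' : ∀ r, 1 / 4 ≤ r →
      HasDerivAt P' ((2 + P' r ^ 2 / 2) / P r + 2 * (κ / r ^ 2 - 1) * P r) r)
    (hP : ∀ r, 1 / 4 ≤ r → 1 / C ≤ P r ∧ P r ≤ C) (hθ : ∀ r, HasDerivAt θ (1 / P r) r)
    (ha : 1 / 4 ≤ a) (hab : a < b) (hb : θ b = θ a + π) :
    π / C ^ 2 ≤ b / P b - a / P a ∧ b / P b - a / P a ≤ π * C ^ 2 := by
  set v : ℝ → ℝ := fun r => √(P r) * sin (θ r - θ a) with hv
  set v' : ℝ → ℝ := fun r => P' r / (2 * √(P r)) * sin (θ r - θ a) + cos (θ r - θ a) / √(P r)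
    with hv'
  set J : ℝ → ℝ := fun r => r * v' r ^ 2 - v r * v' r - (κ / r - r) * v r ^ 2 with hJ
  set Ψ : ℝ → ℝ := fun r => (θ r - θ a) / 2 - sin (θ r - θ a) * cos (θ r - θ a) / 2 with hΨ
  have hJd : ∀ r, 1 / 4 ≤ r → HasDerivAt J (2 * v r ^ 2) r := fun r hr =>
    hasDerivAt_energy (by linarith) (hasDerivAt_sqrt_mul_sin hP0 hP' hθ (θ a) r)
      (hasDerivAt_deriv_sqrt_mul_sin hP0 hP' hθ (hP'' r hr) (θ a))
  have hΨd : ∀ r, HasDerivAt Ψ (sin (θ r - θ a) ^ 2 / P r) r := by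
    intro r
    have h1 := (hθ r).sub_const (θ a)
    convert! (h1.div_const 2).sub ((h1.sin.mul h1.cos).div_const 2) using 1
    have := sin_sq_add_cos_sq (θ r - θ a)
    have hp := (hP0 r).ne'
    field_simp
    linear_combination this
  have hJa : J a = a / P a := by
    simp [hJ, hv, hv', div_eq_mul_inv, sq_sqrt (hP0 a).le]
  have hJb : J b = b / P b := by
    simp [hJ, hv, hv', hb, div_eq_mul_inv, sq_sqrt (hP0 b).le]
  have hΨa : Ψ a = 0 := by simp [hΨ]
  have hΨb : Ψ b = π / 2 := by simp [hΨ, hb]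
  have hdom : ∀ r ∈ Icc a b, 1 / 4 ≤ r := fun r hr => ha.trans hr.1
  have hmono : ∀ {F F' : ℝ → ℝ}, (∀ r ∈ Icc a b, HasDerivAt F (F' r) r) →
      (∀ r ∈ Icc a b, 0 ≤ F' r) → F a ≤ F b := by
    intro F F' h h0
    refine monotoneOn_of_hasDerivWithinAt_nonneg (convex_Icc a b)
      (fun r hr => (h r hr).continuousAt.continuousWithinAt)
      (fun r hr => (h r (interior_subset hr)).hasDerivWithinAt)
      (fun r hr => h0 r (interior_subset hr)) ⟨le_rfl, hab.le⟩ ⟨hab.le, le_rfl⟩ hab.le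
  have hvsq : ∀ r, v r ^ 2 = P r * sin (θ r - θ a) ^ 2 := fun r => by
    rw [hv, mul_pow, sq_sqrt (hP0 r).le]
  have hlow := hmono (fun r hr => (hJd r (hdom r hr)).sub ((hΨd r).const_mul (2 / C ^ 2)))
    (fun r hr => by
      obtain ⟨h1, h2⟩ := hP r (hdom r hr)
      have hp := hP0 r
      have h3 : 1 ≤ C * P r := by rwa [div_le_iff₀' hC] at h1
      have h4 : 1 / C ^ 2 * (1 / P r) ≤ P r := by
        rw [one_div_mul_one_div, div_le_iff₀ (by positivity)]
        nlinarith
      rw [hvsq]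
      have := mul_le_mul_of_nonneg_right h4 (sq_nonneg (sin (θ r - θ a)))
      have e : 2 / C ^ 2 * (sin (θ r - θ a) ^ 2 / P r) =
        2 * (1 / C ^ 2 * (1 / P r) * sin (θ r - θ a) ^ 2) := by ring
      linarith)
  have hup := hmono (fun r hr => ((hΨd r).const_mul (2 * C ^ 2)).sub (hJd r (hdom r hr)))
    (fun r hr => by
      obtain ⟨h1, h2⟩ := hP r (hdom r hr)
      have hp := hP0 r
      have h4 : P r ≤ C ^ 2 * (1 / P r) := by
        rw [mul_one_div, le_div_iff₀ hp]
        nlinarith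
      rw [hvsq]
      have := mul_le_mul_of_nonneg_right h4 (sq_nonneg (sin (θ r - θ a)))
      have e : 2 * C ^ 2 * (sin (θ r - θ a) ^ 2 / P r) =
        2 * (C ^ 2 * (1 / P r) * sin (θ r - θ a) ^ 2) := by ring
      linarith)
  simp only [Pi.sub_apply, hJa, hJb, hΨa, hΨb] at hlow hup
  constructor
  · have : 2 / C ^ 2 * (π / 2) = π / C ^ 2 := by ring
    linarith
  · linarith

/-- Sturm comparison with `cos (3 / 2 * (r - 1))` on `[1 / 2, 3 / 2]`. -/
theorem three_halves_le_of_sturm {v v' : ℝ → ℝ} {κ b : ℝ} (hκ : -(1 / 4) ≤ κ)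
    (hb : 1 / 2 < b) (hv : ∀ r, 1 / 2 ≤ r → HasDerivAt v (v' r) r)
    (hv' : ∀ r, 1 / 2 ≤ r → HasDerivAt v' ((κ / r ^ 2 - 1) * v r) r)
    (ha0 : v (1 / 2) = 0) (hb0 : v b = 0) (ha : 0 < v' (1 / 2)) (hb' : v' b < 0)
    (hpos : ∀ r ∈ Icc (1 / 2) b, 0 ≤ v r) : 3 / 2 ≤ b := by
  by_contra! hlt
  set w : ℝ → ℝ := fun r => cos (3 / 2 * (r - 1)) with hw
  have hwpos : ∀ r ∈ Icc (1 / 2) b, 0 < w r := fun r hr =>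
    cos_pos_of_mem_Ioo ⟨by linarith [hr.1, pi_gt_three], by linarith [hr.2, pi_gt_three]⟩
  have hl : ∀ r : ℝ, HasDerivAt (fun r : ℝ => 3 / 2 * (r - 1)) (3 / 2) r := fun r => by
    simpa using ((hasDerivAt_id r).sub_const 1).const_mul (3 / 2 : ℝ)
  have hd : ∀ r ∈ Icc (1 / 2) b, HasDerivAt
      (fun r => v' r * w r - v r * (-sin (3 / 2 * (r - 1)) * (3 / 2)))
      ((κ / r ^ 2 - 1 + 9 / 4) * v r * w r) r := by
    intro r hr
    convert! ((hv' r hr.1).mul (hl r).cos).sub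
      ((hv r hr.1).mul ((hl r).sin.neg.mul_const (3 / 2))) using 1
    simp only [hw, Pi.neg_apply]
    ring
  have hmono := monotoneOn_of_hasDerivWithinAt_nonneg (convex_Icc (1 / 2) b)
      (fun r hr => (hd r hr).continuousAt.continuousWithinAt)
      (fun r hr => (hd r (interior_subset hr)).hasDerivWithinAt) (fun r hr => by
        have hr := interior_subset hr
        have h1 : -1 ≤ κ / r ^ 2 := by
          have : 0 < r := by linarith [hr.1]
          rw [le_div_iff₀ (by positivity)]
          nlinarith [hr.1]
        exact mul_nonneg (mul_nonneg (by linarith) (hpos r hr)) (hwpos r hr).le)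
      ⟨le_rfl, hb.le⟩ ⟨hb.le, le_rfl⟩ hb.le
  simp only [ha0, hb0, zero_mul, sub_zero] at hmono
  have h1 := mul_pos ha (hwpos _ ⟨le_rfl, hb.le⟩)
  have h2 := mul_neg_of_neg_of_pos hb' (hwpos _ ⟨hb.le, le_rfl⟩)
  linarith

/-- If `θ' = 1 / P` and `B` advances the phase by a constant, then `B' = P(B) / P`. -/
theorem hasStrictDerivAt_phase_shift {P θ B : ℝ → ℝ} {a δ : ℝ} (hP0 : ∀ r, 0 < P r)
    (hθ : ∀ r, HasStrictDerivAt θ (1 / P r) r) (hθi : Function.Injective θ)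
    (hB : ∀ᶠ x in 𝓝 a, θ (B x) = θ x + δ) : HasStrictDerivAt B (P (B a) / P a) a := by
  have hne : (1 / P (B a)) ≠ 0 := (one_div_pos.2 (hP0 _)).ne'
  have hg := (hθ (B a)).to_localInverse hne
  rw [hB.self_of_nhds] at hg
  have hcomp := HasStrictDerivAt.comp (h := fun x => θ x + δ) a hg ((hθ a).add_const δ)
  have hright : ∀ᶠ x in 𝓝 a, θ ((hθ (B a)).localInverse θ (1 / P (B a)) (B a) hne (θ x + δ)) =
      θ x + δ := by
    have h1 : Tendsto (fun x => θ x + δ) (𝓝 a) (𝓝 (θ (B a))) := by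
      rw [hB.self_of_nhds]
      exact ((hθ a).hasDerivAt.continuousAt.add continuousAt_const).tendsto
    exact h1.eventually
      ((hθ (B a)).hasStrictFDerivAt_equiv hne).eventually_right_inverse
  have e : P (B a) / P a = (1 / P (B a))⁻¹ * (1 / P a) := by field_simp
  rw [e]
  refine hcomp.congr_of_eventuallyEq ?_
  filter_upwards [hright, hB] with x h1 h2
  exact hθi (h1.trans h2.symm)

/-- Annuli with first Dirichlet eigenvalue `1 / s ^ 2` are those with radii `s * a` and `s * B a`
for a function `B` with controlled derivative. -/
theorem exists_eigenvalue_parametrization {n : ℕ} (hn : 2 ≤ n) :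
    ∃ (B D : ℝ → ℝ) (M : ℝ), 0 < M ∧ 3 / 2 ≤ B (1 / 2) ∧ ∀ a, 1 / 4 < a →
      HasStrictDerivAt B (D a) a ∧ (1 / M ≤ D a ∧ D a ≤ M) ∧
      (1 / M ≤ B a - a ∧ B a - a ≤ M) ∧ (1 / M ≤ B a - a * D a ∧ B a - a * D a ≤ M) ∧
      ∀ s, 0 < s → dirichletEigenvalue n (annulus n (s * a) (s * B a)) = 1 / s ^ 2 := by
  set κ : ℝ := ((n : ℝ) - 1) * (n - 3) / 4 with hκ
  have hκ' : -(1 / 4) ≤ κ := by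
    have : (2 : ℝ) ≤ n := by exact_mod_cast hn
    rw [hκ]
    nlinarith
  obtain ⟨P, P', C, hC, hP0, hP', hP'', hP⟩ := exists_modulus_sq κ
  have hPc : Continuous fun r => 1 / P r :=
    continuous_const.div (continuous_iff_continuousAt.2 fun r => (hP' r).continuousAt)
      fun r => (hP0 r).ne'
  set θ : ℝ → ℝ := fun r => ∫ x in (0 : ℝ)..r, 1 / P x with hθdef
  have hθs : ∀ r, HasStrictDerivAt θ (1 / P r) r := fun r => hPc.integral_hasStrictDerivAt 0 r
  have hθ : ∀ r, HasDerivAt θ (1 / P r) r := fun r => (hθs r).hasDerivAt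
  have hθm : StrictMono θ := strictMono_of_hasDerivAt_pos hθ fun r => one_div_pos.2 (hP0 r)
  have hθc : Continuous θ := continuous_iff_continuousAt.2 fun r => (hθ r).continuousAt
  have hex : ∀ a, ∃ b, 1 / 4 ≤ a → a < b ∧ θ b = θ a + π := by
    intro a
    by_cases ha : 1 / 4 ≤ a
    · have hlt : a < a + C * π := by have := pi_pos; nlinarith [mul_pos hC pi_pos]
      have h1 := (phase_sub_bounds hC hP hθ ha hlt).1
      have e : (a + C * π - a) / C = π := by field_simp; ring
      rw [e] at h1
      obtain ⟨b, hb, hb'⟩ := intermediate_value_Icc hlt.le hθc.continuousOn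
        (show θ a + π ∈ Icc (θ a) (θ (a + C * π)) from ⟨by linarith [pi_pos], by linarith⟩)
      refine ⟨b, fun _ => ⟨?_, hb'⟩⟩
      rw [← hθm.lt_iff_lt, hb']
      linarith [pi_pos]
    · exact ⟨0, fun h => absurd h ha⟩
  choose B hB using hex
  have hCC : 1 ≤ C ^ 2 := by
    obtain ⟨h1, h2⟩ := hP (1 / 4) le_rfl
    have := h1.trans h2
    rw [div_le_iff₀ hC] at this
    nlinarith
  have hC1 : 1 ≤ C := by nlinarith
  have hpi := pi_gt_three
  have hC3 : C ^ 2 ≤ C ^ 3 := pow_le_pow_right₀ hC1 (by norm_num)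
  have hvd := fun a r => hasDerivAt_sqrt_mul_sin hP0 hP' hθ (θ a) r
  have hvd' := fun a r (hr : 1 / 4 ≤ r) =>
    hasDerivAt_deriv_sqrt_mul_sin hP0 hP' hθ (hP'' r hr) (θ a)
  have hvb : ∀ a, 1 / 4 ≤ a → √(P (B a)) * sin (θ (B a) - θ a) = 0 := fun a ha => by
    simp [(hB a ha).2]
  have hvpos : ∀ a, 1 / 4 ≤ a → ∀ r ∈ Ioo a (B a), 0 < √(P r) * sin (θ r - θ a) := by
    intro a ha r hr
    have h1 := hθm hr.1
    have h2 := hθm hr.2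
    rw [(hB a ha).2] at h2
    exact mul_pos (sqrt_pos.2 (hP0 r)) (sin_pos_of_pos_of_lt_pi (by linarith) (by linarith))
  refine ⟨B, fun a => P (B a) / P a, π * C ^ 3, by positivity, ?_, fun a ha => ?_⟩
  · obtain ⟨h1, h2⟩ := hB (1 / 2) (by norm_num)
    refine three_halves_le_of_sturm hκ' h1 (fun r _ => hvd (1 / 2) r)
      (fun r hr => hvd' (1 / 2) r (by linarith)) (by simp) (hvb _ (by norm_num)) ?_ ?_ ?_
    · simpa using hP0 (1 / 2)
    · rw [h2, add_sub_cancel_left, sin_pi, cos_pi, mul_zero, zero_add]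
      exact div_neg_of_neg_of_pos (by norm_num) (sqrt_pos.2 (hP0 _))
    · intro r hr
      rcases eq_or_lt_of_le hr.1 with rfl | hr1
      · simp
      rcases eq_or_lt_of_le hr.2 with rfl | hr2
      · exact (hvb _ (by norm_num)).ge
      exact (hvpos _ (by norm_num) r ⟨hr1, hr2⟩).le
  obtain ⟨hab, hb⟩ := hB a ha.le
  obtain ⟨hPa1, hPa2⟩ := hP a ha.le
  obtain ⟨hPb1, hPb2⟩ := hP (B a) (ha.le.trans hab.le)
  have hpa := hP0 a
  have hpb := hP0 (B a)
  have hPa1' : 1 ≤ C * P a := by rwa [div_le_iff₀' hC] at hPa1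
  have hPb1' : 1 ≤ C * P (B a) := by rwa [div_le_iff₀' hC] at hPb1
  have hMP : ∀ {x y : ℝ}, x ≤ C → 1 ≤ C * y → 0 < y → x ≤ π * C ^ 3 * y := by
    intro x y hx hy hy0
    calc x ≤ C := hx
      _ ≤ C * (C * y) := le_mul_of_one_le_right hC.le hy
      _ = C ^ 2 * y := by ring
      _ ≤ C ^ 3 * y := by gcongr
      _ ≤ π * (C ^ 3 * y) := le_mul_of_one_le_left (by positivity) (by linarith)
      _ = π * C ^ 3 * y := by ring
  have hK : B a - a * (P (B a) / P a) = P (B a) * (B a / P (B a) - a / P a) := by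
    field_simp
  refine ⟨?_, ⟨?_, ?_⟩, ⟨?_, ?_⟩, ⟨?_, ?_⟩, fun s hs => ?_⟩
  · refine hasStrictDerivAt_phase_shift (δ := π) hP0 hθs hθm.injective ?_
    filter_upwards [Ioi_mem_nhds ha] with x hx
    exact (hB x (le_of_lt hx)).2
  · rw [div_le_div_iff₀ (by positivity) hpa, one_mul, mul_comm]
    exact hMP hPa2 hPb1' hpb
  · rw [div_le_iff₀ hpa]
    exact hMP hPb2 hPa1' hpa
  · have := (phase_sub_bounds hC hP hθ ha.le hab).2
    rw [hb, add_sub_cancel_left] at this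
    rw [div_le_iff₀' (by positivity)]
    have e : π * C ^ 3 * (B a - a) = π * C ^ 2 * (C * (B a - a)) := by ring
    rw [e]
    calc (1 : ℝ) ≤ π * π := by nlinarith
      _ ≤ _ := mul_le_mul (le_mul_of_one_le_right pi_pos.le hCC) this pi_pos.le (by positivity)
  · have := (phase_sub_bounds hC hP hθ ha.le hab).1
    rw [hb, add_sub_cancel_left, div_le_iff₀ hC] at this
    refine this.trans (mul_le_mul_of_nonneg_left ?_ pi_pos.le)
    nlinarith
  · have := (div_modulus_sub_bounds hC hP0 hP' hP'' hP hθ ha.le hab hb).1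
    rw [div_le_iff₀ (by positivity)] at this
    rw [hK, div_le_iff₀' (by positivity)]
    have e : π * C ^ 3 * (P (B a) * (B a / P (B a) - a / P a)) =
      π * (C * P (B a)) * ((B a / P (B a) - a / P a) * C ^ 2) := by ring
    rw [e]
    calc (1 : ℝ) ≤ π * π := by nlinarith
      _ ≤ _ := mul_le_mul (le_mul_of_one_le_right pi_pos.le hPb1') this pi_pos.le (by positivity)
  · have := (div_modulus_sub_bounds hC hP0 hP' hP'' hP hθ ha.le hab hb).2
    rw [hK]
    calc P (B a) * (B a / P (B a) - a / P a) ≤ P (B a) * (π * C ^ 2) := by gcongr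
      _ ≤ C * (π * C ^ 2) := by gcongr
      _ = π * C ^ 3 := by ring
  · exact dirichletEigenvalue_annulus_of_liouville hn (c := 1 / 4) (by norm_num) ha hab hs
      (fun r _ => hvd a r) (fun r hr => hvd' a r hr.le) (by simp) (hvb a ha.le) (hvpos a ha.le)

/-- Local description of the eigenvalues of annuli whose ratio of radii is near `y₀ ∈ (1, 3)`. -/
theorem exists_local_eigenvalue_formula {n : ℕ} (hn : 2 ≤ n) :
    ∃ M : ℝ, 0 < M ∧ ∀ y₀ ∈ Ioo (1 : ℝ) 3, ∃ (g : ℝ → ℝ) (K : ℝ),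
      0 < g y₀ ∧ HasDerivAt g (-g y₀ ^ 2 / K) y₀ ∧
      (∀ᶠ y in 𝓝 y₀, ∀ α, 0 < α → dirichletEigenvalue n (annulus n α (α * y)) = (g y / α) ^ 2) ∧
      (1 / M ≤ K ∧ K ≤ M) ∧ (1 / M ≤ g y₀ * (y₀ - 1) ∧ g y₀ * (y₀ - 1) ≤ M) ∧
      (1 / M ≤ y₀ - K / g y₀ ∧ y₀ - K / g y₀ ≤ M) := by
  obtain ⟨B, D, M, hM, hhalf, h⟩ := exists_eigenvalue_parametrization hn
  refine ⟨M, hM, fun y₀ hy => ?_⟩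
  have hXd : ∀ a, 1 / 4 < a →
      HasStrictDerivAt (fun a => B a / a) ((D a * a - B a) / a ^ 2) a := fun a ha => by
    have ha0 : a ≠ 0 := by positivity
    convert! (h a ha).1.div (hasStrictDerivAt_id a) ha0 using 1
    simp
  obtain ⟨a, ha, hay⟩ : ∃ a, 1 / 4 < a ∧ B a / a = y₀ := by
    set N := M / (y₀ - 1) + 1 with hN
    have hy1 : 0 < y₀ - 1 := sub_pos.2 hy.1
    have hN0 : 1 < N := by rw [hN]; linarith [div_pos hM hy1]
    have hcont : ContinuousOn (fun a => B a / a) (Icc (1 / 2) N) := fun a ha =>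
      (hXd a (by linarith [ha.1])).hasDerivAt.continuousAt.continuousWithinAt
    have h1 : y₀ ≤ B (1 / 2) / (1 / 2) := by
      rw [le_div_iff₀ (by norm_num)]
      linarith [hy.2]
    have h2 : B N / N ≤ y₀ := by
      rw [div_le_iff₀ (by linarith)]
      have h3 := (h N (by linarith)).2.2.1.2
      have h4 : (y₀ - 1) * N = M + (y₀ - 1) := by
        rw [hN]
        field_simp
      linarith
    obtain ⟨a, ha, hay⟩ := intermediate_value_Icc' (by linarith) hcont
      (show y₀ ∈ Icc (B N / N) (B (1 / 2) / (1 / 2)) from ⟨h2, h1⟩)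
    exact ⟨a, by linarith [ha.1], hay⟩
  obtain ⟨-, hD, hL, hK, -⟩ := h a ha
  have ha0 : 0 < a := by linarith
  set K := B a - a * D a with hKdef
  have hK0 : 0 < K := (by positivity : 0 < 1 / M).trans_le hK.1
  have hX' : (D a * a - B a) / a ^ 2 = -K / a ^ 2 := by rw [hKdef]; ring
  have hXa := hXd a ha
  rw [hX'] at hXa
  have hne : -K / a ^ 2 ≠ 0 := div_ne_zero (neg_ne_zero.2 hK0.ne') (by positivity)
  have hg := (hXa.to_localInverse hne).hasDerivAt
  have hga : hXa.localInverse _ _ _ hne (B a / a) = a :=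
    HasStrictFDerivAt.localInverse_apply_image (hXa.hasStrictFDerivAt_equiv hne)
  have hgr := (hXa.hasStrictFDerivAt_equiv hne).eventually_right_inverse
  change ∀ᶠ y in 𝓝 (B a / a), B (hXa.localInverse _ _ _ hne y) /
    hXa.localInverse _ _ _ hne y = y at hgr
  generalize hXa.localInverse _ _ _ hne = g at hg hga hgr
  rw [hay] at hg hga hgr
  have hBa : B a = a * y₀ := by rw [← hay]; field_simp
  refine ⟨g, K, by rw [hga]; exact ha0, ?_, ?_, hK, ?_, ?_⟩
  · rw [hga]
    convert! hg using 1
    rw [inv_div, div_neg, neg_div]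
  · have hev : ∀ᶠ y in 𝓝 y₀, 1 / 4 < g y := by
      refine hg.continuousAt.eventually (Ioi_mem_nhds ?_)
      rwa [hga]
    filter_upwards [hgr, hev] with y h1 h2 α hα
    have hgy : 0 < g y := by linarith
    have h3 := (h (g y) h2).2.2.2.2 (α / g y) (by positivity)
    have e1 : α / g y * g y = α := by field_simp
    have e2 : α / g y * B (g y) = α * y := by
      rw [(div_eq_iff hgy.ne').1 h1]
      field_simp
    rw [e1, e2] at h3
    rw [h3]
    field_simp
  · rw [hga]
    have : a * (y₀ - 1) = B a - a := by rw [hBa]; ring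
    rwa [this]
  · rw [hga]
    have : y₀ - K / a = D a := by rw [hKdef, hBa]; field_simp; ring
    rwa [this]

/-- Differentiability of the eigenvalue in the outer radius. -/
theorem exists_hasDerivAt_dirichletEigenvalue_outer {n : ℕ} (hn : 2 ≤ n) :
    ∃ c > (0 : ℝ), ∃ C > (0 : ℝ), ∀ t ∈ Ioc (0 : ℝ) 1, ∃ d,
      HasDerivAt (fun s => dirichletEigenvalue n (annulus n 1 (1 + s))) d t ∧
      c / t ^ 3 ≤ |d| ∧ |d| ≤ C / t ^ 3 := by
  obtain ⟨M, hM, h⟩ := exists_local_eigenvalue_formula hn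
  refine ⟨2 * (1 / M) ^ 3 / M, by positivity, 2 * M ^ 3 * M, by positivity, fun t ht => ?_⟩
  have ht0 : 0 < t := ht.1
  obtain ⟨g, K, ha, hg, hev, hK, hL, -⟩ := h (1 + t) ⟨by linarith, by linarith [ht.2]⟩
  rw [add_sub_cancel_left] at hL
  set a := g (1 + t) with hadef
  have hK0 : 0 < K := (by positivity : 0 < 1 / M).trans_le hK.1
  have hd : HasDerivAt (fun s => g (1 + s) ^ 2) (2 * a * (-a ^ 2 / K)) t := by
    have := (hg.comp_const_add 1 t).pow 2
    convert! this using 1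
    simp [hadef]
  have hKi : 1 / M ≤ 1 / K ∧ 1 / K ≤ M :=
    ⟨one_div_le_one_div_of_le hK0 hK.2, by rw [one_div_le hK0 hM]; exact hK.1⟩
  have habs : |2 * a * (-a ^ 2 / K)| = 2 * (a * t) ^ 3 * (1 / K) / t ^ 3 := by
    rw [show 2 * a * (-a ^ 2 / K) = -(2 * a ^ 3 / K) by ring, abs_neg,
      abs_of_pos (by positivity)]
    field_simp
  refine ⟨_, hd.congr_of_eventuallyEq ?_, ?_, ?_⟩
  · have hc : Tendsto (fun s : ℝ => 1 + s) (𝓝 t) (𝓝 (1 + t)) :=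
      (continuous_const.add continuous_id).tendsto t
    filter_upwards [hc.eventually hev] with s hs
    have := hs 1 one_pos
    rwa [one_mul, div_one] at this
  · rw [habs, div_eq_mul_one_div (2 * (1 / M) ^ 3) M]
    have := hKi.1
    have := hL.1
    gcongr
  · rw [habs]
    have := hKi.2
    have := hL.2
    gcongr

/-- Differentiability of the eigenvalue in the inner radius. -/
theorem exists_hasDerivAt_dirichletEigenvalue_inner {n : ℕ} (hn : 2 ≤ n) :
    ∃ c > (0 : ℝ), ∃ C > (0 : ℝ), ∀ β > (1 : ℝ), β ≤ 2 → ∀ t ∈ Ico (0 : ℝ) (1 / 4), ∃ d,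
      HasDerivAt (fun s => dirichletEigenvalue n (annulus n (1 - s) β)) d t ∧
      c / (β - (1 - t)) ^ 3 ≤ |d| ∧ |d| ≤ C / (β - (1 - t)) ^ 3 := by
  obtain ⟨M, hM, h⟩ := exists_local_eigenvalue_formula hn
  refine ⟨2 * (1 / M) ^ 3 * (1 / M) * (1 / M), by positivity, 2 * M ^ 3 * M * M, by positivity,
    fun β hβ1 hβ2 t ht => ?_⟩
  set α := 1 - t with hα
  have hα0 : 3 / 4 < α := by linarith [ht.2]
  have hα1 : α ≤ 1 := by linarith [ht.1]
  have hαβ : 0 < β - α := by linarith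
  obtain ⟨g, K, ha, hg, hev, hK, hL, hD⟩ := h (β / α)
    ⟨by rw [lt_div_iff₀ (by linarith)]; linarith, by rw [div_lt_iff₀ (by linarith)]; linarith⟩
  set a := g (β / α) with hadef
  set D := β / α - K / a with hDdef
  have hα' : 0 < α := by linarith
  have hK0 : 0 < K := (by positivity : 0 < 1 / M).trans_le hK.1
  have hD0 : 0 < D := (by positivity : 0 < 1 / M).trans_le hD.1
  have hsub : HasDerivAt (fun s : ℝ => 1 - s) (-1) t := by
    simpa using (hasDerivAt_id t).const_sub 1
  have hdiv : HasDerivAt (fun s : ℝ => β / (1 - s)) (β / α ^ 2) t := by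
    convert! (hasDerivAt_const t β).div hsub hα'.ne' using 1
    simp [hα]
  have hd : HasDerivAt (fun s => (g (β / (1 - s)) / (1 - s)) ^ 2)
      (-(2 * a ^ 3 * D / (K * α ^ 3))) t := by
    convert! ((HasDerivAt.comp (h := fun s : ℝ => β / (1 - s)) t hg hdiv).div hsub
      hα'.ne').pow 2 using 1
    simp only [Function.comp_apply, Pi.div_apply, ← hα, ← hadef, hDdef]
    clear_value α a
    have hα2 : α ≠ 0 := hα'.ne'
    field_simp
    ring_nf
    field_simp
  have hKi : 1 / M ≤ 1 / K ∧ 1 / K ≤ M :=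
    ⟨one_div_le_one_div_of_le hK0 hK.2, by rw [one_div_le hK0 hM]; exact hK.1⟩
  have habs : |-(2 * a ^ 3 * D / (K * α ^ 3))| =
      2 * (a * (β / α - 1)) ^ 3 * (1 / K) * D / (β - α) ^ 3 := by
    rw [abs_neg, abs_of_pos (by positivity), show β / α - 1 = (β - α) / α by field_simp]
    field_simp
  have hL0 : 0 < a * (β / α - 1) := (by positivity : 0 < 1 / M).trans_le hL.1
  refine ⟨_, hd.congr_of_eventuallyEq ?_, ?_, ?_⟩
  · filter_upwards [hdiv.continuousAt.eventually hev,
      hsub.continuousAt.eventually (Ioi_mem_nhds hα')] with s hs hs0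
    have hs0 : 0 < 1 - s := hs0
    have := hs (1 - s) hs0
    rwa [mul_div_cancel₀ _ hs0.ne'] at this
  all_goals
    rw [habs]
    generalize a * (β / α - 1) = L at hL hL0
    obtain ⟨hK1, hK2⟩ := hKi
    obtain ⟨hL1, hL2⟩ := hL
    obtain ⟨hD1, hD2⟩ := hD
    gcongr

theorem stmt_17 (n : ℕ) (hn : 2 ≤ n) :
    (∃ c > (0 : ℝ), ∃ C > (0 : ℝ),
      ∀ t ∈ Set.Ioc (0 : ℝ) 1,
        DifferentiableAt ℝ (fun s => dirichletEigenvalue n (annulus n 1 (1 + s))) t ∧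
        c / t ^ 3 ≤ |deriv (fun s => dirichletEigenvalue n (annulus n 1 (1 + s))) t| ∧
        |deriv (fun s => dirichletEigenvalue n (annulus n 1 (1 + s))) t| ≤ C / t ^ 3) ∧
    (∃ c' > (0 : ℝ), ∃ C' > (0 : ℝ),
      ∀ ε ∈ Set.Ioc (0 : ℝ) 1, ∀ b' : ℝ, 0 ≤ b' → ε + b' ≤ 1 →
        ∀ t ∈ Set.Ico (0 : ℝ) (1 / 4),
          DifferentiableAt ℝ
            (fun s => dirichletEigenvalue n (annulus n (1 - s) (1 + ε + b'))) t ∧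
          c' / (ε + b' + t) ^ 3 ≤
            |deriv (fun s => dirichletEigenvalue n (annulus n (1 - s) (1 + ε + b'))) t| ∧
          |deriv (fun s => dirichletEigenvalue n (annulus n (1 - s) (1 + ε + b'))) t| ≤
            C' / (ε + b' + t) ^ 3) := by
  obtain ⟨c, hc, C, hC, h⟩ := exists_hasDerivAt_dirichletEigenvalue_outer hn
  obtain ⟨c', hc', C', hC', h'⟩ := exists_hasDerivAt_dirichletEigenvalue_inner hn
  refine ⟨⟨c, hc, C, hC, fun t ht => ?_⟩, ⟨c', hc', C', hC', fun ε hε b' hb hεb t ht => ?_⟩⟩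
  · obtain ⟨d, hd, h1, h2⟩ := h t ht
    rw [hd.deriv]
    exact ⟨hd.differentiableAt, h1, h2⟩
  · obtain ⟨d, hd, h1, h2⟩ := h' (1 + ε + b') (by linarith [hε.1]) (by linarith) t ht
    rw [show 1 + ε + b' - (1 - t) = ε + b' + t by ring] at h1 h2
    rw [hd.deriv]
    exact ⟨hd.differentiableAt, h1, h2⟩
end
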